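/- arXiv:1808.01581 — 4 statements merged into one kernel-verified Lean document; each statement's English description precedes it below -/
import Mathlib

section
/- Let n ≥ 4 be even, 0 ≤ a < n, 1 < p < ∞, and let u be a nonnegative solution of (-Δ)^{n/2} u(x) = u(x)^p / |x|^a in ℝ^n (with u ∈ C^n(ℝ^n) if a = 0, and u ∈ C^n(ℝ^n \ {0}) ∩ C^{n-2}(ℝ^n) if 0 < a < n). If either 0 ≤ a ≤ 2 + 2p, or u(x) = o(|x|^2) as |x| → ∞, then u ≡ 0 on ℝ^n. -/
open MeasureTheory Filter Asymptotics Metric Set Real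

noncomputable def laplacian {n : ℕ} (f : EuclideanSpace ℝ (Fin n) → ℝ)
    (x : EuclideanSpace ℝ (Fin n)) : ℝ :=
  ∑ i : Fin n, fderiv ℝ (fun y => fderiv ℝ f y (EuclideanSpace.single i 1)) x
    (EuclideanSpace.single i 1)

/-- `negLapIter k f` is `(-Δ)^k f`, the `k`-fold iterated negative Laplacian. -/
noncomputable def negLapIter {n : ℕ} (k : ℕ) (f : EuclideanSpace ℝ (Fin n) → ℝ) :
    EuclideanSpace ℝ (Fin n) → ℝ :=
  (fun g x => -laplacian g x)^[k] f

/-- The normalizing constant of the Riesz potential of order `α` in `ℝⁿ`. -/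
noncomputable def rieszConst (α : ℝ) (n : ℕ) : ℝ :=
  Real.Gamma (((n : ℝ) - α) / 2) / (Real.pi ^ ((n : ℝ) / 2) * 2 ^ α * Real.Gamma (α / 2))

open scoped ContDiff

theorem lh_integral_fderiv {n : ℕ} (F : EuclideanSpace ℝ (Fin n) → ℝ) (hF : ContDiff ℝ 1 F)
    (hc : HasCompactSupport F) (v : EuclideanSpace ℝ (Fin n)) :
    ∫ x, fderiv ℝ F x v = 0 := by
  have hd : Integrable (fun x => fderiv ℝ F x v) := by
    apply Continuous.integrable_of_hasCompactSupport
    · exact (hF.continuous_fderiv (by norm_num)).clm_apply continuous_const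
    · exact (hc.fderiv ℝ).comp_left (g := fun L : EuclideanSpace ℝ (Fin n) →L[ℝ] ℝ => L v) (by simp)
  have := integral_mul_fderiv_eq_neg_fderiv_mul_of_integrable (μ := volume)
    (f := fun _ => (1:ℝ)) (g := F) (v := v) (by simp) (by simpa using hd)
    (by simpa using hF.continuous.integrable_of_hasCompactSupport hc)
    (fun x _ => by fun_prop) (fun x _ => hF.differentiable (by norm_num) x)
  simpa using this

theorem lh_cont_mul {n : ℕ} {U : Set (EuclideanSpace ℝ (Fin n))} (hU : IsOpen U)
    {v w : EuclideanSpace ℝ (Fin n) → ℝ} {k : ℕ∞ω} (hv : ContDiffOn ℝ k v U)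
    (hw : ContDiff ℝ k w) (hs : tsupport w ⊆ U) : ContDiff ℝ k (fun x => v x * w x) := by
  rw [contDiff_iff_contDiffAt]
  intro x
  by_cases hx : x ∈ tsupport w
  · exact (hv.contDiffAt (hU.mem_nhds (hs hx))).mul hw.contDiffAt
  · have h0 : (fun x => v x * w x) =ᶠ[nhds x] fun _ => 0 := by
      filter_upwards [(isClosed_tsupport w).isOpen_compl.mem_nhds hx] with y hy
      rw [image_eq_zero_of_notMem_tsupport hy, mul_zero]
    exact contDiffAt_const.congr_of_eventuallyEq h0

theorem lh_int_mul {n : ℕ} {U : Set (EuclideanSpace ℝ (Fin n))} (hU : IsOpen U)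
    {v w : EuclideanSpace ℝ (Fin n) → ℝ} (hv : ContDiffOn ℝ 0 v U)
    (hw : ContDiff ℝ 0 w) (hs : tsupport w ⊆ U) (hc : HasCompactSupport w) :
    Integrable (fun x => v x * w x) :=
  (lh_cont_mul hU hv hw hs).continuous.integrable_of_hasCompactSupport hc.mul_left

theorem lh_D_contDiffOn {n : ℕ} {U : Set (EuclideanSpace ℝ (Fin n))} (hU : IsOpen U)
    {v : EuclideanSpace ℝ (Fin n) → ℝ} {k l : ℕ∞ω} (hkl : k + 1 ≤ l) (hv : ContDiffOn ℝ l v U)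
    (e : EuclideanSpace ℝ (Fin n)) : ContDiffOn ℝ k (fun x => fderiv ℝ v x e) U :=
  (hv.fderiv_of_isOpen hU hkl).clm_apply contDiffOn_const

theorem lh_D_contDiff {n : ℕ}
    {v : EuclideanSpace ℝ (Fin n) → ℝ} {k l : ℕ∞ω} (hkl : k + 1 ≤ l) (hv : ContDiff ℝ l v)
    (e : EuclideanSpace ℝ (Fin n)) : ContDiff ℝ k (fun x => fderiv ℝ v x e) :=
  (hv.fderiv_right hkl).clm_apply contDiff_const

theorem lh_D_compact {n : ℕ} {w : EuclideanSpace ℝ (Fin n) → ℝ} (hc : HasCompactSupport w)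
    (e : EuclideanSpace ℝ (Fin n)) : HasCompactSupport (fun x => fderiv ℝ w x e) :=
  (hc.fderiv ℝ).comp_left (g := fun L : EuclideanSpace ℝ (Fin n) →L[ℝ] ℝ => L e) (by simp)

theorem lh_D_tsupport {n : ℕ} (w : EuclideanSpace ℝ (Fin n) → ℝ)
    (e : EuclideanSpace ℝ (Fin n)) : tsupport (fun x => fderiv ℝ w x e) ⊆ tsupport w := by
  refine (closure_mono ?_).trans (tsupport_fderiv_subset ℝ (f := w))
  intro x hx
  simp only [Function.mem_support] at hx ⊢
  intro h
  exact hx (by simp [h])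

theorem lh_ibp {n : ℕ} {U : Set (EuclideanSpace ℝ (Fin n))} (hU : IsOpen U)
    {v w : EuclideanSpace ℝ (Fin n) → ℝ} (hv : ContDiffOn ℝ 1 v U)
    (hw : ContDiff ℝ 1 w) (hs : tsupport w ⊆ U) (hc : HasCompactSupport w)
    (e : EuclideanSpace ℝ (Fin n)) :
    ∫ x, fderiv ℝ v x e * w x = - ∫ x, v x * fderiv ℝ w x e := by
  have h := lh_integral_fderiv _ (lh_cont_mul hU hv hw hs) hc.mul_left e
  have h2 : ∀ x, fderiv ℝ (fun x => v x * w x) x e = fderiv ℝ v x e * w x + v x * fderiv ℝ w x e := by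
    intro x
    by_cases hx : x ∈ tsupport w
    · have h1 : DifferentiableAt ℝ v x :=
        (hv.contDiffAt (hU.mem_nhds (hs hx))).differentiableAt (by norm_num)
      have h2 : DifferentiableAt ℝ w x := hw.differentiable (by norm_num) x
      rw [fderiv_fun_mul h1 h2]
      simp
      ring
    · have h0 : (fun x => v x * w x) =ᶠ[nhds x] fun _ => 0 := by
        filter_upwards [(isClosed_tsupport w).isOpen_compl.mem_nhds hx] with y hy
        rw [image_eq_zero_of_notMem_tsupport hy, mul_zero]
      have h3 : fderiv ℝ w x e = 0 := by
        have := mt (fun h => lh_D_tsupport w e h) hx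
        exact image_eq_zero_of_notMem_tsupport (f := fun x => fderiv ℝ w x e) this
      rw [h0.fderiv_eq, image_eq_zero_of_notMem_tsupport hx, h3]
      simp
  simp_rw [h2] at h
  rw [integral_add] at h
  · linarith
  · exact lh_int_mul hU (lh_D_contDiffOn hU (by norm_num) hv e) (hw.of_le (by norm_num)) hs hc
  · exact lh_int_mul hU (hv.of_le (by norm_num)) (lh_D_contDiff (by norm_num) hw e)
      ((lh_D_tsupport w e).trans hs) (lh_D_compact hc e)

theorem lh_lap_contDiffOn {n : ℕ} {U : Set (EuclideanSpace ℝ (Fin n))} (hU : IsOpen U)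
    {v : EuclideanSpace ℝ (Fin n) → ℝ} {k l : ℕ∞ω} (hkl : k + 1 + 1 ≤ l) (hv : ContDiffOn ℝ l v U) :
    ContDiffOn ℝ k (fun x => -laplacian v x) U := by
  unfold laplacian
  refine ContDiffOn.neg (ContDiffOn.sum fun i _ => ?_)
  exact lh_D_contDiffOn hU le_rfl (lh_D_contDiffOn hU hkl hv _) _

theorem lh_lap_contDiff {n : ℕ}
    {v : EuclideanSpace ℝ (Fin n) → ℝ} {k l : ℕ∞ω} (hkl : k + 1 + 1 ≤ l) (hv : ContDiff ℝ l v) :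
    ContDiff ℝ k (fun x => -laplacian v x) := by
  rw [← contDiffOn_univ] at *
  exact lh_lap_contDiffOn isOpen_univ hkl hv

theorem lh_lap_tsupport {n : ℕ} (w : EuclideanSpace ℝ (Fin n) → ℝ) :
    tsupport (fun x => -laplacian w x) ⊆ tsupport w := by
  apply closure_minimal _ (isClosed_tsupport w)
  intro x hx
  by_contra hn
  apply hx
  unfold laplacian
  simp only [neg_eq_zero]
  refine Finset.sum_eq_zero fun i _ => ?_
  apply image_eq_zero_of_notMem_tsupport
    (f := fun x => fderiv ℝ (fun y => fderiv ℝ w y (EuclideanSpace.single i 1)) x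
    (EuclideanSpace.single i 1))
  exact fun h => hn (lh_D_tsupport _ _ (lh_D_tsupport _ _ h))

theorem lh_compact_of_tsupport {n : ℕ} {w z : EuclideanSpace ℝ (Fin n) → ℝ}
    (h : tsupport z ⊆ tsupport w) (hc : HasCompactSupport w) : HasCompactSupport z :=
  IsCompact.of_isClosed_subset hc (isClosed_tsupport z) h

theorem lh_green {n : ℕ} {U : Set (EuclideanSpace ℝ (Fin n))} (hU : IsOpen U)
    {v w : EuclideanSpace ℝ (Fin n) → ℝ} (hv : ContDiffOn ℝ 2 v U)
    (hw : ContDiff ℝ 2 w) (hs : tsupport w ⊆ U) (hc : HasCompactSupport w) :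
    ∫ x, (-laplacian v x) * w x = ∫ x, v x * (-laplacian w x) := by
  unfold laplacian
  simp only [neg_mul, mul_neg, integral_neg, Finset.sum_mul, Finset.mul_sum]
  congr 1
  have t : (1 + 1 : ℕ∞ω) ≤ 2 := by norm_num [one_add_one_eq_two]
  have t0 : (0 + 1 : ℕ∞ω) ≤ 1 := by norm_num
  have t1 : (1 : ℕ∞ω) ≤ 2 := by norm_num
  rw [integral_finsetSum, integral_finsetSum]
  · refine Finset.sum_congr rfl fun i _ => ?_
    rw [lh_ibp hU (lh_D_contDiffOn hU t hv _) (hw.of_le t1) hs hc,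
      lh_ibp hU (hv.of_le t1) (lh_D_contDiff t hw _) ((lh_D_tsupport w _).trans hs)
        (lh_D_compact hc _), neg_neg]
  · intro i _
    exact lh_int_mul hU (hv.of_le (by norm_num)) (lh_D_contDiff t0 (lh_D_contDiff t hw _) _)
      (((lh_D_tsupport _ _).trans (lh_D_tsupport w _)).trans hs) (lh_D_compact (lh_D_compact hc _) _)
  · intro i _
    exact lh_int_mul hU (lh_D_contDiffOn hU t0 (lh_D_contDiffOn hU t hv _) _)
      (hw.of_le (by norm_num)) hs hc

theorem lh_iter_succ {n : ℕ} (j : ℕ) (f : EuclideanSpace ℝ (Fin n) → ℝ) :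
    negLapIter (j + 1) f = negLapIter j (fun x => -laplacian f x) := by
  unfold negLapIter
  rw [Function.iterate_succ_apply]

theorem lh_iter_succ' {n : ℕ} (j : ℕ) (f : EuclideanSpace ℝ (Fin n) → ℝ) :
    negLapIter (j + 1) f = fun x => -laplacian (negLapIter j f) x := by
  unfold negLapIter
  rw [Function.iterate_succ_apply']

theorem lh_iter_contDiffOn {n : ℕ} {U : Set (EuclideanSpace ℝ (Fin n))} (hU : IsOpen U) (k j : ℕ)
    {v : EuclideanSpace ℝ (Fin n) → ℝ} (hv : ContDiffOn ℝ ((k + 2 * j : ℕ) : ℕ∞ω) v U) :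
    ContDiffOn ℝ k (negLapIter j v) U := by
  induction j generalizing v with
  | zero => simpa [negLapIter] using hv
  | succ j ih =>
    rw [lh_iter_succ]
    apply ih
    refine lh_lap_contDiffOn hU ?_ hv
    norm_cast

theorem lh_iter_smooth {n : ℕ} (j : ℕ)
    {v : EuclideanSpace ℝ (Fin n) → ℝ} (hv : ContDiff ℝ ∞ v) :
    ContDiff ℝ ∞ (negLapIter j v) := by
  induction j generalizing v with
  | zero => simpa [negLapIter] using hv
  | succ j ih =>
    rw [lh_iter_succ]
    apply ih
    refine lh_lap_contDiff ?_ hv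
    norm_cast

theorem lh_iter_tsupport {n : ℕ} (j : ℕ) (w : EuclideanSpace ℝ (Fin n) → ℝ) :
    tsupport (negLapIter j w) ⊆ tsupport w := by
  induction j generalizing w with
  | zero => simp [negLapIter]
  | succ j ih =>
    rw [lh_iter_succ]
    exact (ih _).trans (lh_lap_tsupport w)

theorem lh_two_le : (2 : ℕ∞ω) ≤ ∞ := by
  have : ((2 : ℕ∞) : ℕ∞ω) ≤ ((⊤ : ℕ∞) : ℕ∞ω) := WithTop.coe_le_coe.mpr le_top
  exact this

theorem lh_green_iter {n : ℕ} {U : Set (EuclideanSpace ℝ (Fin n))} (hU : IsOpen U) (j : ℕ)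
    {v w : EuclideanSpace ℝ (Fin n) → ℝ} (hv : ContDiffOn ℝ ((2 * j : ℕ) : ℕ∞ω) v U)
    (hw : ContDiff ℝ ∞ w) (hs : tsupport w ⊆ U) (hc : HasCompactSupport w) :
    ∫ x, negLapIter j v x * w x = ∫ x, v x * negLapIter j w x := by
  induction j generalizing w with
  | zero => simp [negLapIter]
  | succ j ih =>
    rw [lh_iter_succ' j v, lh_iter_succ j w]
    rw [lh_green hU _ (hw.of_le lh_two_le) hs hc]
    · exact ih (hv.of_le (by norm_cast; omega)) (lh_lap_contDiff (by norm_cast) hw)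
        ((lh_lap_tsupport w).trans hs) (lh_compact_of_tsupport (lh_lap_tsupport w) hc)
    · have := lh_iter_contDiffOn hU 2 j (v := v) (hv.of_le (by norm_cast; omega))
      exact_mod_cast this

theorem lh_scale_D {n : ℕ} (c : ℝ) (f : EuclideanSpace ℝ (Fin n) → ℝ)
    (e x : EuclideanSpace ℝ (Fin n)) :
    fderiv ℝ (fun y => f (c • y)) x e = c * fderiv ℝ f (c • x) e := by
  rw [fderiv_comp_smul]
  simp

theorem lh_scale_lap {n : ℕ} (c : ℝ) (f : EuclideanSpace ℝ (Fin n) → ℝ)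
    (x : EuclideanSpace ℝ (Fin n)) :
    laplacian (fun y => f (c • y)) x = c ^ 2 * laplacian f (c • x) := by
  unfold laplacian
  rw [Finset.mul_sum]
  refine Finset.sum_congr rfl fun i _ => ?_
  simp_rw [lh_scale_D]
  rw [show (fun y => c * fderiv ℝ f (c • y) (EuclideanSpace.single i 1)) =
    c • (fun y => fderiv ℝ f (c • y) (EuclideanSpace.single i 1)) from rfl, fderiv_const_smul_field]
  have := lh_scale_D c (fun y => fderiv ℝ f y (EuclideanSpace.single i 1)) (EuclideanSpace.single i 1) x
  simp only [smul_apply, Pi.smul_apply, smul_eq_mul, this]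
  ring

theorem lh_lap_const_mul {n : ℕ} (c : ℝ) (f : EuclideanSpace ℝ (Fin n) → ℝ)
    (x : EuclideanSpace ℝ (Fin n)) :
    laplacian (fun y => c * f y) x = c * laplacian f x := by
  unfold laplacian
  rw [Finset.mul_sum]
  refine Finset.sum_congr rfl fun i _ => ?_
  have h : ∀ (g : EuclideanSpace ℝ (Fin n) → ℝ) (y e), fderiv ℝ (fun z => c * g z) y e = c * fderiv ℝ g y e := by
    intro g y e
    rw [show (fun z => c * g z) = c • g from rfl, fderiv_const_smul_field]
    simp
  simp_rw [h]

theorem lh_scale_iter {n : ℕ} (c : ℝ) (j : ℕ) (f : EuclideanSpace ℝ (Fin n) → ℝ)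
    (x : EuclideanSpace ℝ (Fin n)) :
    negLapIter j (fun y => f (c • y)) x = c ^ (2 * j) * negLapIter j f (c • x) := by
  induction j generalizing x with
  | zero => simp [negLapIter]
  | succ j ih =>
    rw [lh_iter_succ', lh_iter_succ']
    rw [show negLapIter j (fun y => f (c • y)) = fun x => c ^ (2 * j) * negLapIter j f (c • x) from funext ih]
    simp only
    rw [lh_lap_const_mul, lh_scale_lap]
    ring

theorem lh_D_pow {n : ℕ} {h g : EuclideanSpace ℝ (Fin n) → ℝ} (hh : ContDiff ℝ ∞ h)
    (hg : ContDiff ℝ ∞ g) (k : ℕ) (e : EuclideanSpace ℝ (Fin n)) :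
    ∃ g' : EuclideanSpace ℝ (Fin n) → ℝ, ContDiff ℝ ∞ g' ∧
      (fun x => fderiv ℝ (fun y => h y ^ (k + 1) * g y) x e) = fun x => h x ^ k * g' x := by
  refine ⟨fun x => (k + 1) * fderiv ℝ h x e * g x + h x * fderiv ℝ g x e, ?_, ?_⟩
  · have h1 := lh_D_contDiff (k := ∞) (by norm_cast) hh e
    have h2 := lh_D_contDiff (k := ∞) (by norm_cast) hg e
    fun_prop
  · funext x
    have h1 : DifferentiableAt ℝ h x := hh.differentiable (by simp) x
    have h2 : DifferentiableAt ℝ g x := hg.differentiable (by simp) x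
    rw [fderiv_fun_mul (by fun_prop) h2, fderiv_fun_pow _ h1]
    simp
    ring

theorem lh_lap_pow {n : ℕ} {h g : EuclideanSpace ℝ (Fin n) → ℝ} (hh : ContDiff ℝ ∞ h)
    (hg : ContDiff ℝ ∞ g) (k : ℕ) :
    ∃ g' : EuclideanSpace ℝ (Fin n) → ℝ, ContDiff ℝ ∞ g' ∧
      (fun x => -laplacian (fun y => h y ^ (k + 2) * g y) x) = fun x => h x ^ k * g' x := by
  have : ∀ i : Fin n, ∃ g' : EuclideanSpace ℝ (Fin n) → ℝ, ContDiff ℝ ∞ g' ∧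
    (fun x => fderiv ℝ (fun y => fderiv ℝ (fun y => h y ^ (k + 2) * g y) y (EuclideanSpace.single i 1)) x
      (EuclideanSpace.single i 1)) = fun x => h x ^ k * g' x := by
    intro i
    obtain ⟨g1, h1, e1⟩ := lh_D_pow hh hg (k + 1) (EuclideanSpace.single i 1)
    obtain ⟨g2, h2, e2⟩ := lh_D_pow hh h1 k (EuclideanSpace.single i 1)
    refine ⟨g2, h2, ?_⟩
    rw [← e2, ← e1]
  choose G hG hGe using this
  refine ⟨fun x => -∑ i, G i x, ContDiff.neg (ContDiff.sum fun i _ => hG i), ?_⟩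
  funext x
  unfold laplacian
  rw [mul_neg, Finset.mul_sum]
  congr 1
  exact Finset.sum_congr rfl fun i _ => congrFun (hGe i) x

theorem lh_iter_pow {n : ℕ} {h g : EuclideanSpace ℝ (Fin n) → ℝ} (hh : ContDiff ℝ ∞ h)
    (hg : ContDiff ℝ ∞ g) (k j : ℕ) :
    ∃ g' : EuclideanSpace ℝ (Fin n) → ℝ, ContDiff ℝ ∞ g' ∧
      negLapIter j (fun y => h y ^ (k + 2 * j) * g y) = fun x => h x ^ k * g' x := by
  induction j generalizing g with
  | zero => exact ⟨g, hg, by simp [negLapIter]⟩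
  | succ j ih =>
    obtain ⟨g1, h1, e1⟩ := lh_lap_pow hh hg (k + 2 * j)
    obtain ⟨g2, h2, e2⟩ := ih h1
    refine ⟨g2, h2, ?_⟩
    rw [lh_iter_succ, ← e2, ← e1]
    rfl

theorem lh_test {n : ℕ} (m : ℕ) (p : ℝ) (hp : 1 < p) :
    ∃ (φ : EuclideanSpace ℝ (Fin n) → ℝ) (C : ℝ), ContDiff ℝ ∞ φ ∧ (∀ x, 0 ≤ φ x) ∧ (∀ x, φ x ≤ 1) ∧
      (∀ x, ‖x‖ ≤ 1 → φ x = 1) ∧ (∀ x, 2 ≤ ‖x‖ → φ x = 0) ∧ 0 < C ∧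
      ∀ x, |negLapIter m φ x| ≤ C * φ x ^ (1 / p) := by
  let b : ContDiffBump (0 : EuclideanSpace ℝ (Fin n)) := ⟨1, 2, by norm_num, by norm_num⟩
  obtain ⟨k, hk⟩ := exists_nat_gt ((2 * m + 1) / (p - 1))
  have hk0 : k ≠ 0 := by
    rintro rfl
    have : 0 ≤ (2 * (m : ℝ) + 1) / (p - 1) := div_nonneg (by positivity) (by linarith)
    simp at hk
    linarith
  rw [div_lt_iff₀ (by linarith)] at hk
  have hsm : ContDiff ℝ ∞ (b : EuclideanSpace ℝ (Fin n) → ℝ) := b.contDiff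
  obtain ⟨g, hg, hge⟩ := lh_iter_pow (g := fun _ => 1) hsm contDiff_const (k + 1) m
  have hcs : HasCompactSupport (fun x => b x * g x) := b.hasCompactSupport.mul_right
  obtain ⟨C, hC⟩ := hcs.exists_bound_of_continuous (hsm.continuous.mul hg.continuous)
  refine ⟨fun x => b x ^ (k + 1 + 2 * m), |C| + 1, hsm.pow _, fun x => pow_nonneg b.nonneg _,
    fun x => pow_le_one₀ b.nonneg b.le_one, ?_, ?_, by positivity, ?_⟩
  · intro x hx
    have : b x = 1 := b.one_of_mem_closedBall (by simpa using hx)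
    simp [this]
  · intro x hx
    have : b x = 0 := b.zero_of_le_dist (by simpa using hx)
    simp [this]
  · intro x
    simp only [mul_one] at hge
    rw [hge]
    simp only
    rw [pow_succ, mul_assoc, abs_mul, mul_comm, abs_of_nonneg (pow_nonneg b.nonneg k)]
    have h1 := hC x
    rw [Real.norm_eq_abs] at h1
    have h3 : 0 ≤ b x := b.nonneg
    refine mul_le_mul (h1.trans (by linarith [le_abs_self C])) ?_ (pow_nonneg h3 _) (by positivity)
    rcases h3.eq_or_lt with h4 | h4
    · rw [← h4, zero_pow hk0]
      positivity
    · rw [← Real.rpow_natCast, ← Real.rpow_natCast, ← Real.rpow_mul h4.le]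
      apply Real.rpow_le_rpow_of_exponent_ge h4 b.le_one
      push_cast
      rw [mul_one_div, div_le_iff₀ (by linarith)]
      linarith

theorem lh_lap_sub {n : ℕ} {f g : EuclideanSpace ℝ (Fin n) → ℝ} (hf : ContDiff ℝ ∞ f)
    (hg : ContDiff ℝ ∞ g) : (fun x => -laplacian (fun y => f y - g y) x) =
      fun x => (-laplacian f x) - (-laplacian g x) := by
  funext x
  unfold laplacian
  have key : ∀ (f g : EuclideanSpace ℝ (Fin n) → ℝ), ContDiff ℝ ∞ f → ContDiff ℝ ∞ g → ∀ x e,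
      fderiv ℝ (fun y => f y - g y) x e = fderiv ℝ f x e - fderiv ℝ g x e := by
    intro f g hf hg x e
    rw [fderiv_fun_sub (hf.differentiable (by simp) x) (hg.differentiable (by simp) x)]
    rfl
  simp_rw [key f g hf hg]
  rw [Finset.sum_congr rfl fun i _ => key _ _
    (lh_D_contDiff (k := ∞) (by norm_cast) hf (EuclideanSpace.single i 1))
    (lh_D_contDiff (k := ∞) (by norm_cast) hg (EuclideanSpace.single i 1)) x
    (EuclideanSpace.single i 1), Finset.sum_sub_distrib]
  ring

theorem lh_iter_sub {n : ℕ} (j : ℕ) {f g : EuclideanSpace ℝ (Fin n) → ℝ} (hf : ContDiff ℝ ∞ f)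
    (hg : ContDiff ℝ ∞ g) (x : EuclideanSpace ℝ (Fin n)) :
    negLapIter j (fun y => f y - g y) x = negLapIter j f x - negLapIter j g x := by
  induction j generalizing f g with
  | zero => simp [negLapIter]
  | succ j ih =>
    rw [lh_iter_succ, lh_iter_succ, lh_iter_succ, lh_lap_sub hf hg]
    exact ih (lh_lap_contDiff (by norm_cast) hf) (lh_lap_contDiff (by norm_cast) hg)

theorem lh_young (p A b : ℝ) (hp : 1 < p) (hA : 0 ≤ A) (hb : 0 ≤ b) :
    A * b ≤ b ^ p / 2 + (2 * A) ^ (p / (p - 1)) := by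
  have hp1 : 0 < p - 1 := by linarith
  by_cases h : A * b ≤ b ^ p / 2
  · have : 0 ≤ (2 * A) ^ (p / (p - 1)) := by positivity
    linarith
  · push Not at h
    have hb0 : 0 < b := by
      rcases hb.eq_or_lt with h0 | h0
      · rw [← h0, Real.zero_rpow (by linarith)] at h
        simp at h
      · exact h0
    have h1 : b ^ (p - 1) < 2 * A := by
      rw [Real.rpow_sub_one hb0.ne', div_lt_iff₀ hb0]
      linarith
    have h2 : b ≤ (2 * A) ^ (1 / (p - 1)) := by
      calc b = (b ^ (p - 1)) ^ (1 / (p - 1)) := by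
            rw [← Real.rpow_mul hb, mul_one_div, div_self hp1.ne', Real.rpow_one]
        _ ≤ _ := Real.rpow_le_rpow (by positivity) h1.le (by positivity)
    have hA0 : 0 < 2 * A := lt_of_le_of_lt (by positivity) h1
    have h3 : (2 * A) ^ (p / (p - 1)) = (2 * A) * (2 * A) ^ (1 / (p - 1)) := by
      rw [show p / (p - 1) = 1 + 1 / (p - 1) by field_simp; ring, Real.rpow_add hA0, Real.rpow_one]
    rw [h3]
    have h4 : 0 ≤ b ^ p / 2 := by positivity
    have h5 : A * b ≤ 2 * A * (2 * A) ^ (1 / (p - 1)) :=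
      mul_le_mul (by linarith) h2 hb (by linarith)
    linarith

theorem lh_lap_inner {n : ℕ} (m : ℕ) {φ : EuclideanSpace ℝ (Fin n) → ℝ}
    (h1 : ∀ x, ‖x‖ ≤ 1 → φ x = 1) (x : EuclideanSpace ℝ (Fin n)) (hx : ‖x‖ < 1) :
    negLapIter (m + 1) φ x = 0 := by
  rw [lh_iter_succ]
  apply image_eq_zero_of_notMem_tsupport
  intro h
  have h2 := lh_iter_tsupport m _ h
  have h3 : tsupport (fun x => -laplacian φ x) ⊆ {x | 1 ≤ ‖x‖} := by
    apply closure_minimal _ (isClosed_le continuous_const continuous_norm)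
    intro y hy
    by_contra hn
    apply hy
    simp only [mem_ofPred_eq, not_le] at hn
    have he : φ =ᶠ[nhds y] fun _ => 1 := by
      filter_upwards [(isOpen_lt continuous_norm continuous_const).mem_nhds hn] with z hz
      exact h1 z (le_of_lt hz)
    simp only [laplacian, neg_eq_zero]
    refine Finset.sum_eq_zero fun i _ => ?_
    have he2 : (fun y => fderiv ℝ φ y (EuclideanSpace.single i 1)) =ᶠ[nhds y] fun _ => 0 := by
      filter_upwards [he.fderiv (𝕜 := ℝ)] with z hz
      rw [hz]
      simp
    rw [he2.fderiv_eq]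
    simp
  have := h3 h2
  simp only [mem_ofPred_eq] at this
  linarith

theorem lh_scale_compact {n : ℕ} {φ : EuclideanSpace ℝ (Fin n) → ℝ}
    (h2 : ∀ x, 2 ≤ ‖x‖ → φ x = 0) {R : ℝ} (hR : 0 < R) :
    tsupport (fun x => φ (R⁻¹ • x)) ⊆ closedBall 0 (2 * R) := by
  apply closure_minimal _ isClosed_closedBall
  intro x hx
  by_contra hn
  apply hx
  apply h2
  simp only [mem_closedBall, dist_zero_right, not_le] at hn
  rw [norm_smul, norm_inv, Real.norm_of_nonneg hR.le, ← div_eq_inv_mul, le_div_iff₀ hR]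
  exact hn.le

theorem lh_small {n : ℕ} (m : ℕ) (hnm : n = 2 * (m + 1)) (hm : 1 ≤ m)
    {u φ : EuclideanSpace ℝ (Fin n) → ℝ}
    (hu : ContDiff ℝ ((n - 2 : ℕ) : ℕ∞ω) u) (hφ : ContDiff ℝ ∞ φ)
    (h2 : ∀ x, 2 ≤ ‖x‖ → φ x = 0) :
    ∃ K : ℝ, ∀ ε : ℝ, 0 < ε → ε ≤ 1 →
      |∫ x, u x * negLapIter (m + 1) (fun x => φ (ε⁻¹ • x)) x| ≤ K * ε ^ (n - 2) := by
  have hv : Continuous (negLapIter m u) := by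
    have := lh_iter_contDiffOn isOpen_univ 0 m (v := u) (contDiffOn_univ.2 (hu.of_le (by norm_cast; omega)))
    rw [contDiffOn_univ] at this
    exact this.continuous
  obtain ⟨M, hM⟩ := (isCompact_closedBall (0 : EuclideanSpace ℝ (Fin n)) 2).exists_bound_of_continuousOn
    hv.continuousOn
  have hcφ : HasCompactSupport φ := by
    have := lh_scale_compact h2 one_pos
    simp only [inv_one, one_smul] at this
    exact IsCompact.of_isClosed_subset (isCompact_closedBall _ _) (isClosed_tsupport _) this
  obtain ⟨L, hL⟩ := (lh_compact_of_tsupport (lh_lap_tsupport φ) hcφ).exists_bound_of_continuous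
    (lh_lap_contDiff (k := 0) (by norm_cast) (hφ.of_le lh_two_le)).continuous
  have hL0 : 0 ≤ L := (norm_nonneg _).trans (hL 0)
  have hM0 : 0 ≤ M := (norm_nonneg _).trans (hM 0 (by simp))
  refine ⟨M * L * (2 ^ n * volume.real (closedBall (0 : EuclideanSpace ℝ (Fin n)) 1)), fun ε h0 h1 => ?_⟩
  have hsm : ContDiff ℝ ∞ (fun x => φ (ε⁻¹ • x)) := hφ.comp (contDiff_const_smul _)
  have hts := lh_scale_compact h2 h0
  have hcc : HasCompactSupport (fun x => φ (ε⁻¹ • x)) :=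
    IsCompact.of_isClosed_subset (isCompact_closedBall _ _) (isClosed_tsupport _) hts
  rw [lh_iter_succ, ← lh_green_iter isOpen_univ m (contDiffOn_univ.2 (hu.of_le (by norm_cast; omega)))
    (lh_lap_contDiff (by norm_cast) hsm) (subset_univ _)
    (lh_compact_of_tsupport (lh_lap_tsupport _) hcc)]
  rw [← setIntegral_eq_integral_of_forall_compl_eq_zero (s := closedBall 0 (2 * ε))]
  · rw [← Real.norm_eq_abs]
    refine (norm_setIntegral_le_of_norm_le_const (C := M * (ε⁻¹ ^ 2 * L)) ?_ ?_).trans ?_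
    · exact measure_closedBall_lt_top
    · intro x hx
      rw [norm_mul]
      refine mul_le_mul (hM x ?_) ?_ (norm_nonneg _) hM0
      · exact closedBall_subset_closedBall (by linarith) hx
      · rw [lh_scale_lap, ← mul_neg, norm_mul, norm_pow, norm_inv, Real.norm_of_nonneg h0.le]
        exact mul_le_mul_of_nonneg_left (hL _) (by positivity)
    · rw [Measure.addHaar_real_closedBall' _ _ (by positivity)]
      simp only [finrank_euclideanSpace, Fintype.card_fin]
      rw [mul_pow]
      have : ε ^ n = ε ^ (n - 2) * ε ^ 2 := by rw [← pow_add]; congr 1; omega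
      rw [this]
      apply le_of_eq
      field_simp
  · intro x hx
    have : x ∉ tsupport (fun x => -laplacian (fun x => φ (ε⁻¹ • x)) x) :=
      fun h => hx (hts (lh_lap_tsupport _ h))
    rw [image_eq_zero_of_notMem_tsupport this, mul_zero]

theorem lh_point {n : ℕ} (m : ℕ) (hnm : n = 2 * (m + 1)) {a p C : ℝ} (ha : 0 ≤ a) (hp : 1 < p)
    {φ : EuclideanSpace ℝ (Fin n) → ℝ} (hφ0 : ∀ x, 0 ≤ φ x) (hC : 0 < C)
    (h1 : ∀ x, ‖x‖ ≤ 1 → φ x = 1) (h2 : ∀ x, 2 ≤ ‖x‖ → φ x = 0)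
    (hb : ∀ x, |negLapIter (m + 1) φ x| ≤ C * φ x ^ (1 / p))
    {R ε : ℝ} (hR : 0 < R) (hε : 0 < ε) (hεR : 2 * ε ≤ R) (t : ℝ) (ht : 0 ≤ t)
    (hle : ∀ x, φ x ≤ 1)
    (x : EuclideanSpace ℝ (Fin n)) :
    t * negLapIter (m + 1) (fun x => φ (R⁻¹ • x)) x ≤
      (t ^ p / ‖x‖ ^ a) * (φ (R⁻¹ • x) - φ (ε⁻¹ • x)) / 2 +
      (closedBall 0 (2 * R)).indicator
        (fun _ => (2 * (C * R⁻¹ ^ n * (2 * R) ^ (a / p))) ^ (p / (p - 1))) x := by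
  have hnR : ‖R⁻¹ • x‖ = ‖x‖ / R := by
    rw [norm_smul, norm_inv, Real.norm_of_nonneg hR.le, ← div_eq_inv_mul]
  have hnε : ‖ε⁻¹ • x‖ = ‖x‖ / ε := by
    rw [norm_smul, norm_inv, Real.norm_of_nonneg hε.le, ← div_eq_inv_mul]
  have hind : 0 ≤ (closedBall (0 : EuclideanSpace ℝ (Fin n)) (2 * R)).indicator
        (fun _ => (2 * (C * R⁻¹ ^ n * (2 * R) ^ (a / p))) ^ (p / (p - 1))) x :=
    indicator_nonneg (fun _ _ => by positivity) x
  rw [lh_scale_iter]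
  rcases lt_or_ge ‖x‖ R with hx | hx
  · have e1 : ‖R⁻¹ • x‖ < 1 := by rw [hnR, div_lt_one hR]; exact hx
    rw [lh_lap_inner m h1 _ e1, h1 _ e1.le]
    have : 0 ≤ (t ^ p / ‖x‖ ^ a) * (1 - φ (ε⁻¹ • x)) / 2 :=
      div_nonneg (mul_nonneg (by positivity) (by linarith [hle (ε⁻¹ • x)])) (by norm_num)
    simp only [mul_zero]
    linarith
  · have e2 : φ (ε⁻¹ • x) = 0 := by
      apply h2
      rw [hnε, le_div_iff₀ hε]
      linarith
    have hbx := hb (R⁻¹ • x)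
    rw [e2, sub_zero]
    rcases lt_or_ge (2 * R) ‖x‖ with hx2 | hx2
    · have e3 : φ (R⁻¹ • x) = 0 := by
        apply h2
        rw [hnR, le_div_iff₀ hR]
        linarith
      rw [e3, Real.zero_rpow (by positivity), mul_zero] at hbx
      rw [abs_nonpos_iff.1 hbx, e3]
      simpa using hind
    · have hx0 : 0 < ‖x‖ := by linarith
      rw [indicator_of_mem (by simpa using hx2)]
      set s := φ (R⁻¹ • x) with hs
      have hs0 : 0 ≤ s := hφ0 _
      have hp0 : p ≠ 0 := by linarith
      set b := t * s ^ (1 / p) / ‖x‖ ^ (a / p) with hbdef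
      have hb0 : 0 ≤ b := by positivity
      have hbp : b ^ p = t ^ p / ‖x‖ ^ a * s := by
        rw [hbdef, Real.div_rpow (by positivity) (by positivity), Real.mul_rpow ht (by positivity),
          ← Real.rpow_mul hs0, ← Real.rpow_mul hx0.le, div_mul_cancel₀ _ hp0, div_mul_cancel₀ _ hp0,
          Real.rpow_one]
        ring
      have hy := lh_young p (C * R⁻¹ ^ n * (2 * R) ^ (a / p)) b hp (by positivity) hb0
      rw [hbp] at hy
      refine le_trans ?_ hy
      have hts : t * s ^ (1 / p) ≤ b * (2 * R) ^ (a / p) := by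
        have : t * s ^ (1 / p) = b * ‖x‖ ^ (a / p) := by
          rw [hbdef, div_mul_cancel₀]
          positivity
        rw [this]
        exact mul_le_mul_of_nonneg_left (Real.rpow_le_rpow hx0.le hx2 (by positivity)) hb0
      rw [← hnm]
      calc t * (R⁻¹ ^ n * negLapIter (m + 1) φ (R⁻¹ • x))
          ≤ t * (R⁻¹ ^ n * (C * s ^ (1 / p))) := by
            gcongr
            exact (le_abs_self _).trans hbx
        _ = C * R⁻¹ ^ n * (t * s ^ (1 / p)) := by ring
        _ ≤ C * R⁻¹ ^ n * (b * (2 * R) ^ (a / p)) := by gcongr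
        _ = _ := by ring

theorem lh_rate {n : ℕ} {a p C V : ℝ} (han : a < n) (hp : 1 < p) (hC : 0 < C) :
    Tendsto (fun R : ℝ => (2 * (C * R⁻¹ ^ n * (2 * R) ^ (a / p))) ^ (p / (p - 1)) *
      ((2 * R) ^ n * V)) atTop (nhds 0) := by
  have hp1 : 0 < p - 1 := by linarith
  have hg : 0 < (n - a) / (p - 1) := div_pos (by linarith) hp1
  have h := (tendsto_rpow_neg_atTop hg).const_mul
    ((2 * C * 2 ^ (a / p)) ^ (p / (p - 1)) * (2 ^ n * V))
  rw [mul_zero] at h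
  refine h.congr' ?_
  filter_upwards [eventually_gt_atTop 0] with R hR
  have e1 : 2 * (C * R⁻¹ ^ n * (2 * R) ^ (a / p)) = (2 * C * 2 ^ (a / p)) * R ^ (-(n : ℝ) + a / p) := by
    rw [Real.mul_rpow (by norm_num) hR.le, Real.rpow_add hR, Real.rpow_neg hR.le, Real.rpow_natCast,
      inv_pow]
    ring
  rw [e1, Real.mul_rpow (x := 2 * C * 2 ^ (a / p)) (y := R ^ (-(n : ℝ) + a / p)) (by positivity)
    (by positivity), ← Real.rpow_mul hR.le, mul_pow]
  have e2 : R ^ (-((n - a) / (p - 1))) = R ^ ((-(n : ℝ) + a / p) * (p / (p - 1))) * R ^ n := by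
    rw [← Real.rpow_natCast R n, ← Real.rpow_add hR]
    congr 1
    field_simp
    ring
  rw [e2]
  ring

theorem lh_main
    (n m : ℕ) (hnm : n = 2 * (m + 1)) (hm : 1 ≤ m) (a p : ℝ)
    (ha0 : 0 ≤ a) (han : a < n) (hp : 1 < p)
    (u : EuclideanSpace ℝ (Fin n) → ℝ)
    (hu0 : ∀ x, 0 ≤ u x)
    (hU : ContDiffOn ℝ n u {(0 : EuclideanSpace ℝ (Fin n))}ᶜ)
    (hG : ContDiff ℝ (n - 2 : ℕ) u)
    (heq : ∀ x : EuclideanSpace ℝ (Fin n), x ≠ 0 →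
      negLapIter (m + 1) u x = u x ^ p / ‖x‖ ^ a)
    (x₀ : EuclideanSpace ℝ (Fin n)) (hx₀ : x₀ ≠ 0) : u x₀ = 0 := by
  by_contra hux
  have hpos : 0 < u x₀ := lt_of_le_of_ne (hu0 x₀) (Ne.symm hux)
  have hn0 : 0 < ‖x₀‖ := norm_pos_iff.2 hx₀
  obtain ⟨φ, C, hφ, hφ0, hφ1, h1, h2, hC, hb⟩ := lh_test (n := n) (m + 1) p hp
  obtain ⟨K, hK⟩ := lh_small m hnm hm hG hφ h2
  have hopen : IsOpen ({(0 : EuclideanSpace ℝ (Fin n))}ᶜ) := isOpen_compl_singleton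
  set f : EuclideanSpace ℝ (Fin n) → ℝ := fun x => u x ^ p / ‖x‖ ^ a with hf
  have hf0 : ∀ x, 0 ≤ f x := fun x => by have := hu0 x; positivity
  have hfc : ContDiffOn ℝ 0 f {(0 : EuclideanSpace ℝ (Fin n))}ᶜ := by
    rw [contDiffOn_zero]
    intro x hx
    have hxn : ‖x‖ ≠ 0 := norm_ne_zero_iff.2 hx
    have huc : ContinuousAt u x := hG.continuous.continuousAt
    apply ContinuousAt.continuousWithinAt
    refine ContinuousAt.div (huc.rpow_const (Or.inr (by linarith)))
      (continuous_norm.continuousAt.rpow_const (Or.inl hxn)) ?_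
    have : 0 < ‖x‖ := lt_of_le_of_ne (norm_nonneg _) hxn.symm
    positivity
  let ψ : ContDiffBump x₀ := ⟨‖x₀‖ / 4, ‖x₀‖ / 2, by positivity, by linarith⟩
  have hψs : tsupport ψ ⊆ {(0 : EuclideanSpace ℝ (Fin n))}ᶜ := by
    rw [ψ.tsupport_eq]
    intro x hx h0
    rw [mem_singleton_iff] at h0
    subst h0
    simp only [mem_closedBall, dist_zero_left] at hx
    change ‖x₀‖ ≤ ‖x₀‖ / 2 at hx
    linarith
  have hψc : ContDiff ℝ 0 (ψ : EuclideanSpace ℝ (Fin n) → ℝ) := ψ.contDiff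
  have hI : 0 < ∫ x, f x * ψ x := by
    refine Continuous.integral_pos_of_hasCompactSupport_nonneg_nonzero
      (lh_cont_mul hopen hfc hψc hψs).continuous ψ.hasCompactSupport.mul_left
      (fun x => mul_nonneg (hf0 x) ψ.nonneg) (x := x₀) ?_
    rw [ψ.one_of_mem_closedBall (by simp; positivity), mul_one]
    simp only [hf]
    positivity
  have hbound : ∀ᶠ R : ℝ in atTop, ∫ x, f x * ψ x ≤
      2 * ((2 * (C * R⁻¹ ^ n * (2 * R) ^ (a / p))) ^ (p / (p - 1)) *
      ((2 * R) ^ n * volume.real (closedBall (0 : EuclideanSpace ℝ (Fin n)) 1))) +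
      2 * (K * R⁻¹ ^ (n - 2)) := by
    filter_upwards [eventually_ge_atTop 2, eventually_ge_atTop (2 * ‖x₀‖),
      eventually_ge_atTop (4 / ‖x₀‖)] with R hR2 hRx hRi
    have hR : 0 < R := by linarith
    obtain ⟨ε, hεdef⟩ : ∃ ε, ε = R⁻¹ := ⟨_, rfl⟩
    have hε : 0 < ε := by rw [hεdef]; positivity
    have hε2 : ε ≤ 1 / 2 := by rw [hεdef, one_div]; exact inv_anti₀ (by norm_num) hR2
    have hεx : 4 * ε ≤ ‖x₀‖ := by
      rw [hεdef]
      rw [div_le_iff₀ hn0] at hRi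
      rw [← div_eq_mul_inv, div_le_iff₀ hR]
      linarith
    set φR : EuclideanSpace ℝ (Fin n) → ℝ := fun x => φ (R⁻¹ • x) with hφR
    set φε : EuclideanSpace ℝ (Fin n) → ℝ := fun x => φ (ε⁻¹ • x) with hφε
    have sR : ContDiff ℝ ∞ φR := hφ.comp (contDiff_const_smul _)
    have sε : ContDiff ℝ ∞ φε := hφ.comp (contDiff_const_smul _)
    have cR : HasCompactSupport φR := IsCompact.of_isClosed_subset (isCompact_closedBall _ _)
      (isClosed_tsupport _) (lh_scale_compact h2 hR)
    have cε : HasCompactSupport φε := IsCompact.of_isClosed_subset (isCompact_closedBall _ _)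
      (isClosed_tsupport _) (lh_scale_compact h2 hε)
    have one_of : ∀ (r : ℝ) (x : EuclideanSpace ℝ (Fin n)), 0 < r → ‖x‖ ≤ r → φ (r⁻¹ • x) = 1 := by
      intro r x hr hx
      apply h1
      rw [norm_smul, norm_inv, Real.norm_of_nonneg hr.le, ← div_eq_inv_mul, div_le_one hr]
      exact hx
    have zero_of : ∀ (r : ℝ) (x : EuclideanSpace ℝ (Fin n)), 0 < r → 2 * r ≤ ‖x‖ → φ (r⁻¹ • x) = 0 := by
      intro r x hr hx
      apply h2
      rw [norm_smul, norm_inv, Real.norm_of_nonneg hr.le, ← div_eq_inv_mul, le_div_iff₀ hr]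
      exact hx
    have sw : ContDiff ℝ ∞ (fun x => φR x - φε x) := sR.sub sε
    have cw : HasCompactSupport (fun x => φR x - φε x) := by
      have := cR.sub cε
      exact this
    have tw : tsupport (fun x => φR x - φε x) ⊆ {(0 : EuclideanSpace ℝ (Fin n))}ᶜ := by
      have : tsupport (fun x => φR x - φε x) ⊆ {x | ε ≤ ‖x‖} := by
        apply closure_minimal _ (isClosed_le continuous_const continuous_norm)
        intro x hx
        by_contra hn
        apply hx
        simp only [mem_ofPred_eq, not_le] at hn
        simp only [hφR, hφε]
        rw [one_of R x hR (by linarith), one_of ε x hε hn.le, sub_self]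
      intro x hx h0
      rw [mem_singleton_iff] at h0
      subst h0
      have := this hx
      simp only [mem_ofPred_eq, norm_zero] at this
      linarith
    have hw0 : ∀ x, 0 ≤ φR x - φε x := by
      intro x
      simp only [hφR, hφε]
      rcases le_total ‖x‖ R with h | h
      · rw [one_of R x hR h]
        linarith [hφ1 (ε⁻¹ • x)]
      · rw [zero_of ε x hε (by linarith)]
        linarith [hφ0 (R⁻¹ • x)]
    have iw : Integrable (fun x => f x * (φR x - φε x)) :=
      lh_int_mul hopen hfc (sw.of_le (by simp)) tw cw
    have iψ : Integrable (fun x => f x * ψ x) :=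
      lh_int_mul hopen hfc hψc hψs ψ.hasCompactSupport
    have step1 : ∫ x, f x * ψ x ≤ ∫ x, f x * (φR x - φε x) := by
      refine integral_mono iψ iw fun x => mul_le_mul_of_nonneg_left ?_ (hf0 x)
      rcases lt_or_ge (dist x x₀) (‖x₀‖ / 2) with h | h
      · have hl : ‖x‖ ≤ ‖x₀‖ + ‖x₀‖ / 2 := by
          have := norm_le_norm_add_norm_sub' x x₀
          rw [← dist_eq_norm] at this
          linarith
        have hl2 : ‖x₀‖ / 2 ≤ ‖x‖ := by
          have := norm_le_norm_add_norm_sub x x₀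
          rw [← dist_eq_norm] at this
          linarith
        simp only [hφR, hφε]
        rw [one_of R x hR (by linarith), zero_of ε x hε (by linarith), sub_zero]
        exact ψ.le_one
      · rw [ψ.zero_of_le_dist h]
        exact hw0 x
    have cu : ContDiffOn ℝ 0 u univ := contDiffOn_univ.2 (hG.of_le (by simp))
    have iint : ∀ φ' : EuclideanSpace ℝ (Fin n) → ℝ, ContDiff ℝ ∞ φ' → HasCompactSupport φ' →
        Integrable (fun x => u x * negLapIter (m + 1) φ' x) := fun φ' s c =>
      lh_int_mul isOpen_univ cu ((lh_iter_smooth (m + 1) s).of_le (by simp)) (subset_univ _)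
        (lh_compact_of_tsupport (lh_iter_tsupport _ _) c)
    have step2 : ∫ x, f x * (φR x - φε x) =
        (∫ x, u x * negLapIter (m + 1) φR x) - ∫ x, u x * negLapIter (m + 1) φε x := by
      rw [← integral_sub (iint _ sR cR) (iint _ sε cε)]
      have hU2 : ContDiffOn ℝ ((2 * (m + 1) : ℕ) : ℕ∞ω) u {(0 : EuclideanSpace ℝ (Fin n))}ᶜ :=
        hU.of_le (by norm_cast; omega)
      rw [show (fun x => u x * negLapIter (m + 1) φR x - u x * negLapIter (m + 1) φε x) =
        fun x => u x * negLapIter (m + 1) (fun x => φR x - φε x) x by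
          funext x; rw [lh_iter_sub _ sR sε]; ring]
      rw [← lh_green_iter hopen (m + 1) hU2 sw tw cw]
      apply integral_congr_ae
      refine Eventually.of_forall fun x => ?_
      by_cases hx : x = 0
      · have : φR x - φε x = 0 := by
          simp only [hφR, hφε]
          rw [one_of R x hR (by simp [hx]; exact hR.le), one_of ε x hε (by simp [hx]; exact hε.le), sub_self]
        simp only [this, mul_zero]
      · simp only [heq x hx, hf]
    have hvfin : volume (closedBall (0 : EuclideanSpace ℝ (Fin n)) (2 * R)) ≠ ⊤ :=
      measure_closedBall_lt_top.ne
    have step3 : ∫ x, u x * negLapIter (m + 1) φR x ≤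
        (∫ x, f x * (φR x - φε x)) / 2 +
        (2 * (C * R⁻¹ ^ n * (2 * R) ^ (a / p))) ^ (p / (p - 1)) *
        ((2 * R) ^ n * volume.real (closedBall (0 : EuclideanSpace ℝ (Fin n)) 1)) := by
      have iI : Integrable ((closedBall (0 : EuclideanSpace ℝ (Fin n)) (2 * R)).indicator
        (fun _ => (2 * (C * R⁻¹ ^ n * (2 * R) ^ (a / p))) ^ (p / (p - 1)))) :=
        (integrable_indicator_iff measurableSet_closedBall).2 (integrableOn_const hvfin)
      have := integral_mono (iint _ sR cR) ((iw.div_const 2).add iI)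
        (fun x => lh_point m hnm ha0 hp hφ0 hC h1 h2 hb hR hε (by linarith) (u x) (hu0 x) hφ1 x)
      refine this.trans (le_of_eq ?_)
      simp only [Pi.add_apply]
      rw [integral_add (iw.div_const 2) iI, integral_div, integral_indicator measurableSet_closedBall,
        setIntegral_const, Measure.addHaar_real_closedBall' _ _ (by positivity)]
      simp only [finrank_euclideanSpace, Fintype.card_fin, smul_eq_mul]
      ring
    have step4 := hK ε hε (by linarith)
    have step5 := (abs_le.1 step4).1
    rw [← hεdef] at step3 ⊢
    linarith
  have hlim : Tendsto (fun R : ℝ => 2 * ((2 * (C * R⁻¹ ^ n * (2 * R) ^ (a / p))) ^ (p / (p - 1)) *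
      ((2 * R) ^ n * volume.real (closedBall (0 : EuclideanSpace ℝ (Fin n)) 1))) +
      2 * (K * R⁻¹ ^ (n - 2))) atTop (nhds 0) := by
    have l1 := (lh_rate (V := volume.real (closedBall (0 : EuclideanSpace ℝ (Fin n)) 1)) han hp hC).const_mul 2
    have l2 := (((tendsto_inv_atTop_zero (𝕜 := ℝ)).pow (n - 2)).const_mul K).const_mul 2
    rw [zero_pow (by omega)] at l2
    simpa using l1.add l2
  have := ge_of_tendsto hlim hbound
  linarith

theorem liouville_critical_lane_emden_hardy
    (n : ℕ) (hn4 : 4 ≤ n) (hne : Even n) (a p : ℝ)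
    (ha0 : 0 ≤ a) (han : a < n) (hp : 1 < p)
    (u : EuclideanSpace ℝ (Fin n) → ℝ)
    (hu0 : ∀ x, 0 ≤ u x)
    (hreg0 : a = 0 → ContDiff ℝ n u)
    (hreg1 : 0 < a → ContDiffOn ℝ n u {(0 : EuclideanSpace ℝ (Fin n))}ᶜ ∧
      ContDiff ℝ (n - 2 : ℕ) u)
    (heq : ∀ x : EuclideanSpace ℝ (Fin n), x ≠ 0 →
      negLapIter (n / 2) u x = u x ^ p / ‖x‖ ^ a)
    (heq0 : a = 0 → negLapIter (n / 2) u 0 = u 0 ^ p / ‖(0 : EuclideanSpace ℝ (Fin n))‖ ^ a)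
    (hcond : a ≤ 2 + 2 * p ∨
      u =o[cocompact (EuclideanSpace ℝ (Fin n))] fun x => ‖x‖ ^ 2) :
    ∀ x, u x = 0 := by
  obtain ⟨m, hnm, hm⟩ : ∃ m, n = 2 * (m + 1) ∧ 1 ≤ m := by
    obtain ⟨k, hk⟩ := hne
    exact ⟨k - 1, by omega, by omega⟩
  have hdiv : n / 2 = m + 1 := by omega
  rw [hdiv] at heq
  have hreg : ContDiffOn ℝ n u {(0 : EuclideanSpace ℝ (Fin n))}ᶜ ∧ ContDiff ℝ (n - 2 : ℕ) u := by
    rcases ha0.eq_or_lt with h | h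
    · have := hreg0 h.symm
      exact ⟨this.contDiffOn, this.of_le (by norm_cast; omega)⟩
    · exact hreg1 h
  have key := lh_main n m hnm hm a p ha0 han hp u hu0 hreg.1 hreg.2 heq
  haveI : Nonempty (Fin n) := ⟨⟨0, by omega⟩⟩
  have hd : Dense ({(0 : EuclideanSpace ℝ (Fin n))}ᶜ) := dense_compl_singleton 0
  have := Continuous.ext_on hd hreg.2.continuous continuous_const
    (fun x hx => (key x hx : u x = (fun _ => (0 : ℝ)) x))
  exact fun x => congrFun this x
end

section
/- Let n ≥ 4 be even, 0 ≤ a < n, 1 < p < ∞, and let u be a nonnegative classical solution of (-Δ)^{n/2} u = u^p/|x|^a in ℝ^n. If either 0 ≤ a ≤ 2 + 2p or u(x) = o(|x|^2) as |x| → ∞, then (-Δ)^i u(x) ≥ 0 for every i = 1, ..., n/2 - 1 and all x ∈ ℝ^n (super poly-harmonic property). -/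
open MeasureTheory Filter Asymptotics Metric Set Real

section Helpers
open scoped ContDiff

lemma negLapIter_succ {n : ℕ} (k : ℕ) (f : EuclideanSpace ℝ (Fin n) → ℝ) :
    negLapIter (k + 1) f = fun x => -laplacian (negLapIter k f) x := by
  unfold negLapIter
  rw [Function.iterate_succ_apply']

lemma pd_contDiffOn {n : ℕ} {f : EuclideanSpace ℝ (Fin n) → ℝ} {s : Set (EuclideanSpace ℝ (Fin n))}
    (hs : IsOpen s) {k : ℕ} (hf : ContDiffOn ℝ (k + 1 : ℕ) f s) (v : EuclideanSpace ℝ (Fin n)) :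
    ContDiffOn ℝ k (fun x => fderiv ℝ f x v) s :=
  (hf.fderiv_of_isOpen hs (m := (k : WithTop ℕ∞)) (by norm_cast)).clm_apply contDiffOn_const

lemma lap_contDiffOn {n : ℕ} {f : EuclideanSpace ℝ (Fin n) → ℝ} {s : Set (EuclideanSpace ℝ (Fin n))}
    (hs : IsOpen s) {k : ℕ} (hf : ContDiffOn ℝ (k + 2 : ℕ) f s) :
    ContDiffOn ℝ k (laplacian f) s := by
  have : laplacian f = fun x => ∑ i : Fin n,
    fderiv ℝ (fun y => fderiv ℝ f y (EuclideanSpace.single i 1)) x (EuclideanSpace.single i 1) := rfl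
  rw [this]
  exact ContDiffOn.sum fun i _ => pd_contDiffOn hs (pd_contDiffOn hs hf _) _

lemma negLapIter_contDiffOn {n : ℕ} {f : EuclideanSpace ℝ (Fin n) → ℝ}
    {s : Set (EuclideanSpace ℝ (Fin n))}
    (hs : IsOpen s) (j : ℕ) : ∀ {k : ℕ}, ContDiffOn ℝ (k + 2 * j : ℕ) f s →
    ContDiffOn ℝ k (negLapIter j f) s := by
  induction j with
  | zero => intro k h; simpa [negLapIter] using h
  | succ j ih =>
    intro k h
    rw [negLapIter_succ]
    refine (lap_contDiffOn hs (ih ?_)).neg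
    convert h using 2
    ring

lemma pd_smooth {n : ℕ} {f : EuclideanSpace ℝ (Fin n) → ℝ} (hf : ContDiff ℝ ∞ f)
    (v : EuclideanSpace ℝ (Fin n)) : ContDiff ℝ ∞ (fun x => fderiv ℝ f x v) :=
  (hf.fderiv_right (m := ∞) (by simp)).clm_apply contDiff_const

lemma lap_smooth {n : ℕ} {f : EuclideanSpace ℝ (Fin n) → ℝ} (hf : ContDiff ℝ ∞ f) :
    ContDiff ℝ ∞ (laplacian f) := by
  have : laplacian f = fun x => ∑ i : Fin n,
    fderiv ℝ (fun y => fderiv ℝ f y (EuclideanSpace.single i 1)) x (EuclideanSpace.single i 1) := rfl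
  rw [this]
  exact ContDiff.sum fun i _ => pd_smooth (pd_smooth hf _) _

lemma negLapIter_smooth {n : ℕ} {f : EuclideanSpace ℝ (Fin n) → ℝ} (hf : ContDiff ℝ ∞ f) (k : ℕ) :
    ContDiff ℝ ∞ (negLapIter k f) := by
  induction k with
  | zero => simpa [negLapIter] using hf
  | succ k ih => rw [negLapIter_succ]; exact (lap_smooth ih).neg

lemma tsupport_pd {n : ℕ} (f : EuclideanSpace ℝ (Fin n) → ℝ) (v : EuclideanSpace ℝ (Fin n)) :
    tsupport (fun x => fderiv ℝ f x v) ⊆ tsupport f :=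
  tsupport_fderiv_apply_subset ℝ v

lemma support_lap {n : ℕ} (f : EuclideanSpace ℝ (Fin n) → ℝ) {x : EuclideanSpace ℝ (Fin n)}
    (hx : x ∉ tsupport f) : laplacian f x = 0 := by
  unfold laplacian
  refine Finset.sum_eq_zero fun i _ => ?_
  by_contra h
  exact hx (tsupport_pd f _ (tsupport_pd _ _ (subset_tsupport _ (Function.mem_support.2 h))))

lemma tsupport_negLapIter {n : ℕ} (f : EuclideanSpace ℝ (Fin n) → ℝ) (k : ℕ) :
    tsupport (negLapIter k f) ⊆ tsupport f := by
  induction k with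
  | zero => simp [negLapIter]
  | succ k ih =>
    refine subset_trans ?_ ih
    rw [negLapIter_succ]
    refine closure_minimal (fun x hx => ?_) (isClosed_tsupport _)
    by_contra h
    exact hx (by simp [support_lap _ h])

lemma cont_mul {n : ℕ} {w g : EuclideanSpace ℝ (Fin n) → ℝ} {s : Set (EuclideanSpace ℝ (Fin n))}
    (hs : IsOpen s) (hw : ContinuousOn w s) (hg : Continuous g) (hgs : tsupport g ⊆ s) :
    Continuous (fun x => w x * g x) := by
  refine continuous_of_tsupport fun x hx => ?_
  have : x ∈ tsupport g := tsupport_mul_subset_right (f := w) hx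
  exact (hw.continuousAt (hs.mem_nhds (hgs this))).mul hg.continuousAt

lemma int_mul {n : ℕ} {w g : EuclideanSpace ℝ (Fin n) → ℝ} {s : Set (EuclideanSpace ℝ (Fin n))}
    (hs : IsOpen s) (hw : ContinuousOn w s) (hg : Continuous g) (hgs : tsupport g ⊆ s)
    (hc : HasCompactSupport g) : Integrable (fun x => w x * g x) :=
  (cont_mul hs hw hg hgs).integrable_of_hasCompactSupport hc.mul_left

lemma green {n : ℕ} {w ψ : EuclideanSpace ℝ (Fin n) → ℝ} {s : Set (EuclideanSpace ℝ (Fin n))}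
    (hs : IsOpen s) (hw : ContDiffOn ℝ 2 w s) (hψ : ContDiff ℝ ∞ ψ) (hψs : tsupport ψ ⊆ s)
    (hc : HasCompactSupport ψ) :
    ∫ x, w x * laplacian ψ x = ∫ x, laplacian w x * ψ x := by
  have hw2 : ContDiffOn ℝ (0 + 1 + 1 : ℕ) w s := by simpa using hw
  unfold laplacian
  simp only [Finset.mul_sum, Finset.sum_mul]
  have h1 : ∀ i : Fin n, ContDiffOn ℝ (0 + 1 : ℕ)
      (fun x => fderiv ℝ w x (EuclideanSpace.single i 1)) s := fun i => pd_contDiffOn hs hw2 _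
  have h2 : ∀ i : Fin n, ContinuousOn (fun x => fderiv ℝ (fun y => fderiv ℝ w y
      (EuclideanSpace.single i 1)) x (EuclideanSpace.single i 1)) s :=
    fun i => (pd_contDiffOn hs (h1 i) _).continuousOn
  have hp1 : ∀ i : Fin n, ContDiff ℝ ∞ (fun x => fderiv ℝ ψ x (EuclideanSpace.single i 1)) :=
    fun i => pd_smooth hψ _
  have hp2 : ∀ i : Fin n, ContDiff ℝ ∞ (fun x => fderiv ℝ (fun y => fderiv ℝ ψ y
      (EuclideanSpace.single i 1)) x (EuclideanSpace.single i 1)) := fun i => pd_smooth (hp1 i) _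
  have hc1 : ∀ i : Fin n, HasCompactSupport (fun x => fderiv ℝ ψ x (EuclideanSpace.single i 1)) :=
    fun i => hc.of_isClosed_subset (isClosed_tsupport _) (tsupport_pd _ _)
  have hc2 : ∀ i : Fin n, HasCompactSupport (fun x => fderiv ℝ (fun y => fderiv ℝ ψ y
      (EuclideanSpace.single i 1)) x (EuclideanSpace.single i 1)) :=
    fun i => (hc1 i).of_isClosed_subset (isClosed_tsupport _) (tsupport_pd _ _)
  have hs1 : ∀ i : Fin n, tsupport (fun x => fderiv ℝ ψ x (EuclideanSpace.single i 1)) ⊆ s :=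
    fun i => (tsupport_pd _ _).trans hψs
  have hs2 : ∀ i : Fin n, tsupport (fun x => fderiv ℝ (fun y => fderiv ℝ ψ y
      (EuclideanSpace.single i 1)) x (EuclideanSpace.single i 1)) ⊆ s :=
    fun i => (tsupport_pd _ _).trans (hs1 i)
  rw [integral_finsetSum _ fun i _ => int_mul hs hw.continuousOn (hp2 i).continuous (hs2 i) (hc2 i),
    integral_finsetSum _ fun i _ => int_mul hs (h2 i) hψ.continuous hψs hc]
  refine Finset.sum_congr rfl fun i _ => ?_
  rw [integral_mul_fderiv_eq_neg_fderiv_mul_of_integrable, ← neg_eq_iff_eq_neg.2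
    (integral_mul_fderiv_eq_neg_fderiv_mul_of_integrable (μ := volume)
      (f := fun x => fderiv ℝ w x (EuclideanSpace.single i 1)) (g := ψ)
      (v := EuclideanSpace.single i 1) ?_ ?_ ?_ ?_ ?_)]
  · exact int_mul hs (h2 i) hψ.continuous hψs hc
  · exact int_mul hs (h1 i).continuousOn (hp1 i).continuous (hs1 i) (hc1 i)
  · exact int_mul hs (h1 i).continuousOn hψ.continuous hψs hc
  · intro x hx
    exact ((h1 i).contDiffAt (hs.mem_nhds (hψs hx))).differentiableAt (by simp)
  · intro x hx
    exact hψ.differentiable (by simp) x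
  · exact int_mul hs (h1 i).continuousOn (hp1 i).continuous (hs1 i) (hc1 i)
  · exact int_mul hs hw.continuousOn (hp2 i).continuous (hs2 i) (hc2 i)
  · exact int_mul hs hw.continuousOn (hp1 i).continuous (hs1 i) (hc1 i)
  · intro x hx
    exact (hw.contDiffAt (hs.mem_nhds (hs1 i hx))).differentiableAt (by simp)
  · intro x hx
    exact (hp1 i).differentiable (by simp) x

lemma fd_const_mul {n : ℕ} {f : EuclideanSpace ℝ (Fin n) → ℝ} (c : ℝ)
    (x : EuclideanSpace ℝ (Fin n)) :
    fderiv ℝ (fun y => c • f y) x = c • fderiv ℝ f x := by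
  have := congrFun (fderiv_const_smul_field (𝕜 := ℝ) (f := f) c) x
  exact this

lemma lap_scale {n : ℕ} {f : EuclideanSpace ℝ (Fin n) → ℝ} (c : ℝ)
    (x : EuclideanSpace ℝ (Fin n)) :
    laplacian (fun y => f (c • y)) x = c ^ 2 * laplacian f (c • x) := by
  unfold laplacian
  rw [Finset.mul_sum]
  refine Finset.sum_congr rfl fun i _ => ?_
  have h1 : (fun y => fderiv ℝ (fun z => f (c • z)) y (EuclideanSpace.single i 1))
      = fun y => c • (fun z => fderiv ℝ f z (EuclideanSpace.single i 1)) (c • y) := by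
    funext y
    rw [fderiv_comp_smul]
    simp
  rw [h1, fd_const_mul (f := fun y => (fun z => fderiv ℝ f z (EuclideanSpace.single i 1)) (c • y)),
    fderiv_comp_smul (f := fun z => fderiv ℝ f z (EuclideanSpace.single i 1))]
  simp
  ring

lemma lap_const_mul {n : ℕ} {f : EuclideanSpace ℝ (Fin n) → ℝ} (c : ℝ)
    (x : EuclideanSpace ℝ (Fin n)) :
    laplacian (fun y => c * f y) x = c * laplacian f x := by
  unfold laplacian
  rw [Finset.mul_sum]
  refine Finset.sum_congr rfl fun i _ => ?_
  have h1 : (fun y => fderiv ℝ (fun z => c * f z) y (EuclideanSpace.single i 1))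
      = fun y => c • (fderiv ℝ f y (EuclideanSpace.single i 1)) := by
    funext y
    have := fd_const_mul (f := f) c y
    simp only [smul_eq_mul] at this
    rw [this]
    simp
  rw [h1, fd_const_mul]
  simp

lemma negLapIter_scale {n : ℕ} {f : EuclideanSpace ℝ (Fin n) → ℝ} (c : ℝ) (k : ℕ) :
    negLapIter k (fun y => f (c • y)) = fun x => c ^ (2 * k) * negLapIter k f (c • x) := by
  induction k with
  | zero => simp [negLapIter]
  | succ k ih =>
    rw [negLapIter_succ, ih, negLapIter_succ]
    funext x
    rw [lap_const_mul (f := fun x => negLapIter k f (c • x)), lap_scale]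
    ring

lemma negLapIter_zero {n : ℕ} (k : ℕ) :
    negLapIter k (fun _ : EuclideanSpace ℝ (Fin n) => (0 : ℝ)) = fun _ => 0 := by
  induction k with
  | zero => simp [negLapIter]
  | succ k ih =>
    rw [negLapIter_succ, ih]
    funext x
    simp [laplacian]

/-- The iterated Laplacian of a high power is divisible by a high power. -/
lemma negLapIter_pow {n : ℕ} {ψ : EuclideanSpace ℝ (Fin n) → ℝ} (hψ : ContDiff ℝ ∞ ψ) (k : ℕ) :
    ∀ N : ℕ, ∃ g : EuclideanSpace ℝ (Fin n) → ℝ, ContDiff ℝ ∞ g ∧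
      negLapIter k (fun x => ψ x ^ (N + 2 * k)) = fun x => g x * ψ x ^ N := by
  have hpd : ∀ (g : EuclideanSpace ℝ (Fin n) → ℝ) (N : ℕ) (v : EuclideanSpace ℝ (Fin n)),
      ContDiff ℝ ∞ g → (fun x => fderiv ℝ (fun y => g y * ψ y ^ (N + 1)) x v) =
        fun x => (fderiv ℝ g x v * ψ x + (N + 1) * g x * fderiv ℝ ψ x v) * ψ x ^ N := by
    intro g N v hg
    funext x
    have d1 : HasFDerivAt g (fderiv ℝ g x) x := (hg.differentiable (by simp) x).hasFDerivAt
    have d2 : HasFDerivAt ψ (fderiv ℝ ψ x) x := (hψ.differentiable (by simp) x).hasFDerivAt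
    rw [(d1.fun_mul (d2.pow (N + 1))).fderiv]
    simp
    ring
  induction k with
  | zero => intro N; exact ⟨fun _ => 1, contDiff_const, by simp [negLapIter]⟩
  | succ k ih =>
    intro N
    obtain ⟨g, hg, h⟩ := ih (N + 1 + 1)
    have e : N + 2 * (k + 1) = N + 1 + 1 + 2 * k := by ring
    rw [e, negLapIter_succ, h]
    have key : ∀ i : Fin n, ∃ g2 : EuclideanSpace ℝ (Fin n) → ℝ, ContDiff ℝ ∞ g2 ∧
        (fun x => fderiv ℝ (fun y => fderiv ℝ (fun x => g x * ψ x ^ (N + 1 + 1)) y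
          (EuclideanSpace.single i 1)) x (EuclideanSpace.single i 1)) = fun x => g2 x * ψ x ^ N := by
      intro i
      have hg1 : ContDiff ℝ ∞ (fun x => fderiv ℝ g x (EuclideanSpace.single i 1) * ψ x +
          ((N + 1 : ℕ) + 1) * g x * fderiv ℝ ψ x (EuclideanSpace.single i 1)) :=
        ((pd_smooth hg _).mul hψ).add ((contDiff_const.mul hg).mul (pd_smooth hψ _))
      rw [hpd g (N + 1) _ hg, hpd _ N _ hg1]
      refine ⟨_, ?_, rfl⟩
      exact ((pd_smooth hg1 _).mul hψ).add ((contDiff_const.mul hg1).mul (pd_smooth hψ _))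
    choose g2 hg2 hh using key
    refine ⟨fun x => -∑ i, g2 i x, (ContDiff.sum fun i _ => hg2 i).neg, ?_⟩
    funext x
    unfold laplacian
    rw [neg_mul, Finset.sum_mul]
    congr 1
    exact Finset.sum_congr rfl fun i _ => congrFun (hh i) x

/-- Laplacian of a product. -/
lemma lap_mul {n : ℕ} {f g : EuclideanSpace ℝ (Fin n) → ℝ} (hf : ContDiff ℝ ∞ f)
    (hg : ContDiff ℝ ∞ g) (x : EuclideanSpace ℝ (Fin n)) :
    laplacian (fun y => f y * g y) x = f x * laplacian g x + g x * laplacian f x +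
      2 * ∑ i : Fin n, fderiv ℝ f x (EuclideanSpace.single i 1) *
        fderiv ℝ g x (EuclideanSpace.single i 1) := by
  unfold laplacian
  rw [Finset.mul_sum, Finset.mul_sum, Finset.mul_sum, ← Finset.sum_add_distrib,
    ← Finset.sum_add_distrib]
  refine Finset.sum_congr rfl fun i _ => ?_
  have hpd : ∀ (f g : EuclideanSpace ℝ (Fin n) → ℝ) (v x : EuclideanSpace ℝ (Fin n)),
      ContDiff ℝ ∞ f → ContDiff ℝ ∞ g → HasFDerivAt (fun y => f y * g y)
        (f x • fderiv ℝ g x + g x • fderiv ℝ f x) x := by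
    intro f g v x hf hg
    exact (hf.differentiable (by simp) x).hasFDerivAt.fun_mul (hg.differentiable (by simp) x).hasFDerivAt
  have h1 : (fun y => fderiv ℝ (fun y => f y * g y) y (EuclideanSpace.single i 1)) =
      fun y => f y * fderiv ℝ g y (EuclideanSpace.single i 1) +
        g y * fderiv ℝ f y (EuclideanSpace.single i 1) := by
    funext y
    rw [(hpd f g 0 y hf hg).fderiv]
    simp
  rw [h1, ((hpd f _ 0 x hf (pd_smooth hg _)).fun_add (hpd g _ 0 x hg (pd_smooth hf _))).fderiv]
  simp
  ring

lemma lap_sub {n : ℕ} {f g : EuclideanSpace ℝ (Fin n) → ℝ} (hf : ContDiff ℝ ∞ f)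
    (hg : ContDiff ℝ ∞ g) (x : EuclideanSpace ℝ (Fin n)) :
    laplacian (fun y => f y - g y) x = laplacian f x - laplacian g x := by
  unfold laplacian
  rw [← Finset.sum_sub_distrib]
  refine Finset.sum_congr rfl fun i _ => ?_
  have hpd : ∀ (f g : EuclideanSpace ℝ (Fin n) → ℝ) (x : EuclideanSpace ℝ (Fin n)),
      ContDiff ℝ ∞ f → ContDiff ℝ ∞ g →
      fderiv ℝ (fun y => f y - g y) x = fderiv ℝ f x - fderiv ℝ g x := by
    intro f g x hf hg
    exact ((hf.differentiable (by simp) x).hasFDerivAt.fun_sub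
      (hg.differentiable (by simp) x).hasFDerivAt).fderiv
  have h1 : (fun y => fderiv ℝ (fun y => f y - g y) y (EuclideanSpace.single i 1)) =
      fun y => fderiv ℝ f y (EuclideanSpace.single i 1) -
        fderiv ℝ g y (EuclideanSpace.single i 1) := by
    funext y
    rw [hpd f g y hf hg]
    simp
  rw [h1, hpd _ _ x (pd_smooth hf _) (pd_smooth hg _)]
  simp

lemma weakA {n : ℕ} {u φ : EuclideanSpace ℝ (Fin n) → ℝ} {M : ℕ} (hu : ContDiff ℝ (2 * M : ℕ) u)
    (hφ : ContDiff ℝ ∞ φ) (hc : HasCompactSupport φ) (j : ℕ) : ∀ k : ℕ, j ≤ M →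
    ∫ x, u x * negLapIter (k + j) φ x = ∫ x, negLapIter j u x * negLapIter k φ x := by
  induction j with
  | zero => intro k _; simp [negLapIter]
  | succ j ih =>
    intro k hj
    have e : k + (j + 1) = (k + 1) + j := by ring
    rw [e, ih (k + 1) (by omega), negLapIter_succ, negLapIter_succ]
    simp only [mul_neg, neg_mul, integral_neg]
    congr 1
    refine green isOpen_univ ?_ (negLapIter_smooth hφ k) (subset_univ _)
      (hc.of_isClosed_subset (isClosed_tsupport _) (tsupport_negLapIter _ _))
    have := negLapIter_contDiffOn (f := u) isOpen_univ j (k := 2)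
      ((hu.of_le (by norm_cast; omega)).contDiffOn)
    simpa using this

lemma bdd_of_cs {n : ℕ} {F : Type*} [NormedAddCommGroup F] {f : EuclideanSpace ℝ (Fin n) → F}
    (hf : Continuous f) (hc : HasCompactSupport f) : ∃ C : ℝ, 0 ≤ C ∧ ∀ x, ‖f x‖ ≤ C := by
  obtain ⟨C, hC⟩ := hf.bounded_above_of_compact_support hc
  exact ⟨C, (norm_nonneg _).trans (hC 0), hC⟩

lemma cs_lap {n : ℕ} {φ : EuclideanSpace ℝ (Fin n) → ℝ} (hc : HasCompactSupport φ) :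
    HasCompactSupport (laplacian φ) :=
  HasCompactSupport.intro hc.isCompact fun _ hx => support_lap _ hx

lemma lap_bound {n : ℕ} {φ η : EuclideanSpace ℝ (Fin n) → ℝ}
    (hφ : ContDiff ℝ ∞ φ) (hc : HasCompactSupport φ)
    (hη : ContDiff ℝ ∞ η) (hcη : HasCompactSupport η) :
    ∃ C : ℝ, 0 ≤ C ∧ ∀ c : ℝ, 1 ≤ c → ∀ x,
      |laplacian (fun y => φ y * η (c • y)) x| ≤ C * c ^ 2 := by
  obtain ⟨A0, hA0, hA0'⟩ := bdd_of_cs hφ.continuous hc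
  obtain ⟨B0, hB0, hB0'⟩ := bdd_of_cs hη.continuous hcη
  obtain ⟨A1, hA1, hA1'⟩ := bdd_of_cs (hφ.continuous_fderiv (by simp)) (hc.fderiv (𝕜 := ℝ))
  obtain ⟨B1, hB1, hB1'⟩ := bdd_of_cs (hη.continuous_fderiv (by simp)) (hcη.fderiv (𝕜 := ℝ))
  obtain ⟨A2, hA2, hA2'⟩ := bdd_of_cs (lap_smooth hφ).continuous (cs_lap hc)
  obtain ⟨B2, hB2, hB2'⟩ := bdd_of_cs (lap_smooth hη).continuous (cs_lap hcη)
  simp only [Real.norm_eq_abs] at hA0' hB0' hA2' hB2'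
  refine ⟨A0 * B2 + B0 * A2 + 2 * (n * (A1 * B1)), by positivity, fun c hc1 x => ?_⟩
  have hηc : ContDiff ℝ ∞ (fun y => η (c • y)) := hη.comp (contDiff_const_smul c)
  rw [lap_mul hφ hηc, lap_scale]
  have t1 : |φ x * (c ^ 2 * laplacian η (c • x))| ≤ A0 * B2 * c ^ 2 := by
    rw [abs_mul, abs_mul, abs_of_nonneg (by positivity : (0:ℝ) ≤ c ^ 2)]
    calc |φ x| * (c ^ 2 * |laplacian η (c • x)|) ≤ A0 * (c ^ 2 * B2) := by
          gcongr
          · exact hA0' x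
          · exact hB2' _
      _ = _ := by ring
  have t2 : |η (c • x) * laplacian φ x| ≤ B0 * A2 * c ^ 2 := by
    rw [abs_mul]
    calc |η (c • x)| * |laplacian φ x| ≤ B0 * A2 := by
          gcongr
          · exact hB0' _
          · exact hA2' x
      _ ≤ _ := le_mul_of_one_le_right (by positivity) (one_le_pow₀ hc1)
  have t3 : |∑ i : Fin n, fderiv ℝ φ x (EuclideanSpace.single i 1) *
        fderiv ℝ (fun y => η (c • y)) x (EuclideanSpace.single i 1)| ≤ n * (A1 * B1) * c ^ 2 := by
    refine (Finset.abs_sum_le_sum_abs _ _).trans ?_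
    calc _ ≤ ∑ i : Fin n, A1 * B1 * c ^ 2 := by
          refine Finset.sum_le_sum fun i _ => ?_
          rw [abs_mul, fderiv_comp_smul]
          have a1 : |fderiv ℝ φ x (EuclideanSpace.single i 1)| ≤ A1 := by
            have := (fderiv ℝ φ x).le_opNorm (EuclideanSpace.single i 1)
            simp at this
            exact this.trans (hA1' x)
          have a2 : |fderiv ℝ η (c • x) (EuclideanSpace.single i 1)| ≤ B1 := by
            have := (fderiv ℝ η (c • x)).le_opNorm (EuclideanSpace.single i 1)
            simp at this
            exact this.trans (hB1' _)
          have a3 : |(c • fderiv ℝ η (c • x)) (EuclideanSpace.single i 1)| ≤ c ^ 2 * B1 := by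
            simp only [_root_.smul_apply, smul_eq_mul, abs_mul]
            rw [abs_of_nonneg (by linarith : 0 ≤ c)]
            have : c ≤ c ^ 2 := by nlinarith
            gcongr
          calc _ ≤ A1 * (c ^ 2 * B1) := by gcongr
            _ = _ := by ring
      _ = _ := by simp; ring
  calc _ ≤ |φ x * (c ^ 2 * laplacian η (c • x))| + |η (c • x) * laplacian φ x| +
      2 * |∑ i : Fin n, fderiv ℝ φ x (EuclideanSpace.single i 1) *
        fderiv ℝ (fun y => η (c • y)) x (EuclideanSpace.single i 1)| := by
        refine (abs_add_le _ _).trans (add_le_add (abs_add_le _ _) ?_)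
        rw [abs_mul]; simp
    _ ≤ _ := by linarith

lemma weakB {n : ℕ} (hn : 3 ≤ n) {w f φ : EuclideanSpace ℝ (Fin n) → ℝ}
    (hw : Continuous w) (hw2 : ContDiffOn ℝ 2 w {0}ᶜ)
    (hf : ∀ x, x ≠ 0 → -laplacian w x = f x)
    (hφ : ContDiff ℝ ∞ φ) (hc : HasCompactSupport φ)
    (hfφ : Integrable (fun x => f x * φ x)) :
    ∫ x, w x * -laplacian φ x = ∫ x, f x * φ x := by
  have : Nonempty (Fin n) := ⟨⟨0, by omega⟩⟩
  let η : ContDiffBump (0 : EuclideanSpace ℝ (Fin n)) := ⟨1, 2, by norm_num, by norm_num⟩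
  have hη : ContDiff ℝ ∞ η := η.contDiff
  have hcη : HasCompactSupport η := η.hasCompactSupport
  obtain ⟨C, hC, hCb⟩ := lap_bound hφ hc hη hcη
  obtain ⟨W, hW⟩ := (isCompact_closedBall (0 : EuclideanSpace ℝ (Fin n)) 2).exists_bound_of_continuousOn
    hw.continuousOn
  let c : ℕ → ℝ := fun k => (k : ℝ) + 1
  have hc1 : ∀ k, 1 ≤ c k := fun k => by simp [c]
  have hc0 : ∀ k, 0 < c k := fun k => by linarith [hc1 k]
  have hηk : ∀ k, ContDiff ℝ ∞ (fun y => η (c k • y)) := fun k => hη.comp (contDiff_const_smul _)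
  have hφη : ∀ k, ContDiff ℝ ∞ (fun y => φ y * η (c k • y)) := fun k => hφ.mul (hηk k)
  -- supports
  have hz : ∀ k x, x ∉ closedBall (0 : EuclideanSpace ℝ (Fin n)) (2 / c k) →
      laplacian (fun y => φ y * η (c k • y)) x = 0 := by
    intro k x hx
    refine support_lap _ fun hx' => hx ?_
    have hsub : tsupport (fun y => φ y * η (c k • y)) ⊆ closedBall 0 (2 / c k) := by
      refine closure_minimal (fun y hy => ?_) isClosed_closedBall
      have h1 : η (c k • y) ≠ 0 := right_ne_zero_of_mul hy
      have h2 : c k • y ∈ ball (0 : EuclideanSpace ℝ (Fin n)) 2 := by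
        have : c k • y ∈ Function.support η := h1
        rwa [η.support_eq] at this
      rw [mem_ball_zero_iff, norm_smul, Real.norm_eq_abs, abs_of_pos (hc0 k)] at h2
      rw [mem_closedBall_zero_iff, le_div_iff₀ (hc0 k)]
      linarith
    exact hsub hx'
  have hsmall : Tendsto (fun k => ∫ x, w x * laplacian (fun y => φ y * η (c k • y)) x) atTop
      (nhds 0) := by
    have hb : ∀ k, ‖∫ x, w x * laplacian (fun y => φ y * η (c k • y)) x‖ ≤
        (|W| * C * 2 ^ n * volume.real (closedBall (0 : EuclideanSpace ℝ (Fin n)) 1)) * (1 / c k) := by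
      intro k
      rw [← setIntegral_eq_integral_of_forall_compl_eq_zero
        (s := closedBall (0 : EuclideanSpace ℝ (Fin n)) (2 / c k))
        (fun x hx => by rw [hz k x hx, mul_zero])]
      have h2c : 2 / c k ≤ 2 := div_le_self (by norm_num) (hc1 k)
      refine (norm_setIntegral_le_of_norm_le_const (C := |W| * (C * c k ^ 2))
        measure_closedBall_lt_top (fun x hx => ?_)).trans ?_
      · rw [norm_mul]
        have := (hW x (closedBall_subset_closedBall h2c hx)).trans (le_abs_self W)
        have h3 := hCb (c k) (hc1 k) x
        rw [Real.norm_eq_abs (laplacian _ _)]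
        gcongr
      · rw [Measure.addHaar_real_closedBall' _ _ (by have := hc0 k; positivity)]
        simp only [finrank_euclideanSpace, Fintype.card_fin]
        obtain ⟨d, rfl⟩ := Nat.exists_eq_add_of_le hn
        have hp : c k ^ 2 * (2 / c k) ^ (3 + d) ≤ 2 ^ (3 + d) * (1 / c k) := by
          have := hc0 k
          rw [div_pow, pow_add (c k)]
          have h5 : 1 ≤ c k ^ d := one_le_pow₀ (hc1 k)
          have : c k ^ 2 * (2 ^ (3 + d) / (c k ^ 3 * c k ^ d)) =
            2 ^ (3 + d) * (1 / c k) / c k ^ d := by field_simp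
          rw [this]
          exact div_le_self (by positivity) h5
        calc _ = (|W| * C * volume.real (closedBall (0 : EuclideanSpace ℝ (Fin (3 + d))) 1)) *
              (c k ^ 2 * (2 / c k) ^ (3 + d)) := by ring
          _ ≤ (|W| * C * volume.real (closedBall (0 : EuclideanSpace ℝ (Fin (3 + d))) 1)) *
              (2 ^ (3 + d) * (1 / c k)) := by gcongr
          _ = _ := by ring
    refine squeeze_zero_norm hb ?_
    have := (tendsto_one_div_add_atTop_nhds_zero_nat (𝕜 := ℝ)).const_mul
      (|W| * C * 2 ^ n * volume.real (closedBall (0 : EuclideanSpace ℝ (Fin n)) 1))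
    simpa [c] using this
  have hid : ∀ k, ∫ x, w x * -laplacian φ x =
      (∫ x, f x * (φ x - φ x * η (c k • x))) -
        ∫ x, w x * laplacian (fun y => φ y * η (c k • y)) x := by
    intro k
    have hnear : ∀ x ∈ ball (0 : EuclideanSpace ℝ (Fin n)) (1 / c k),
        φ x - φ x * η (c k • x) = 0 := by
      intro x hx
      have : η (c k • x) = 1 := by
        refine η.one_of_mem_closedBall ?_
        rw [mem_ball_zero_iff, lt_div_iff₀ (hc0 k)] at hx
        rw [mem_closedBall_zero_iff, norm_smul, Real.norm_eq_abs, abs_of_pos (hc0 k)]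
        change _ ≤ (1 : ℝ)
        linarith
      rw [this]; ring
    have hcs1 : HasCompactSupport (fun y => φ y * η (c k • y)) := hc.mul_right
    have hG := green (isOpen_compl_singleton (x := (0 : EuclideanSpace ℝ (Fin n)))) hw2
      (hφ.sub (hφη k)) (?_) (hc.sub hcs1)
    · have h1 : ∫ x, w x * laplacian (fun y => φ y - φ y * η (c k • y)) x =
          (∫ x, w x * laplacian φ x) - ∫ x, w x * laplacian (fun y => φ y * η (c k • y)) x := by
        rw [← integral_sub]
        · refine integral_congr_ae (Eventually.of_forall fun x => ?_)
          simp only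
          rw [lap_sub hφ (hφη k)]; ring
        · exact int_mul isOpen_univ hw.continuousOn (lap_smooth hφ).continuous (subset_univ _)
            (cs_lap hc)
        · exact int_mul isOpen_univ hw.continuousOn (lap_smooth (hφη k)).continuous (subset_univ _)
            (cs_lap hcs1)
      have h2 : ∫ x, laplacian w x * (φ x - φ x * η (c k • x)) =
          -∫ x, f x * (φ x - φ x * η (c k • x)) := by
        rw [← integral_neg]
        refine integral_congr_ae (Eventually.of_forall fun x => ?_)
        simp only
        by_cases hx : x = 0
        · rw [hnear x (by rw [hx]; exact mem_ball_self (by have := hc0 k; positivity))]; simp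
        · rw [← hf x hx]; ring
      rw [h1, h2] at hG
      simp only [mul_neg, integral_neg]
      linarith
    · intro x hx hx0
      rw [mem_singleton_iff] at hx0
      subst hx0
      refine notMem_tsupport_iff_eventuallyEq.2 ?_ hx
      filter_upwards [ball_mem_nhds (0 : EuclideanSpace ℝ (Fin n))
        (by have := hc0 k; positivity : 0 < 1 / c k)] with y hy using hnear y hy
  have hlim : Tendsto (fun k => ∫ x, f x * (φ x - φ x * η (c k • x))) atTop
      (nhds (∫ x, f x * φ x)) := by
    refine tendsto_integral_of_dominated_convergence (fun x => ‖f x * φ x‖) ?_ hfφ.norm ?_ ?_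
    · intro k
      have : (fun x => f x * (φ x - φ x * η (c k • x))) =
        fun x => f x * φ x * (1 - η (c k • x)) := by funext x; ring
      rw [this]
      exact hfφ.aestronglyMeasurable.mul
        (continuous_const.sub (hηk k).continuous).aestronglyMeasurable
    · intro k
      refine Eventually.of_forall fun x => ?_
      have : f x * (φ x - φ x * η (c k • x)) = f x * φ x * (1 - η (c k • x)) := by ring
      rw [this, norm_mul]
      refine mul_le_of_le_one_right (norm_nonneg _) ?_
      rw [Real.norm_eq_abs, abs_le]
      constructor <;> linarith [η.nonneg (x := c k • x), η.le_one (x := c k • x)]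
    · have hne : ∀ᵐ x : EuclideanSpace ℝ (Fin n), x ≠ 0 := by
        simp [ae_iff]
      filter_upwards [hne] with x hx
      refine tendsto_const_nhds.congr' ?_
      have : Tendsto (fun k => c k * ‖x‖) atTop atTop :=
        (tendsto_atTop_add_const_right _ _ tendsto_natCast_atTop_atTop).atTop_mul_const
          (norm_pos_iff.2 hx)
      filter_upwards [this.eventually_ge_atTop 2] with k hk
      have : η (c k • x) = 0 := by
        refine η.zero_of_le_dist ?_
        rw [dist_zero_right, norm_smul, Real.norm_eq_abs, abs_of_pos (hc0 k)]
        exact hk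
      rw [this]; ring
  have hfin := hlim.sub hsmall
  rw [sub_zero] at hfin
  refine tendsto_nhds_unique (tendsto_const_nhds.congr hid) hfin

/-- A nonnegative solution of the critical order inequality vanishes
(rescaled test function method). -/
lemma u_eq_zero {n m : ℕ} (hn : 3 ≤ n) (hm : n = 2 * m) {a p : ℝ}
    (ha0 : 0 ≤ a) (han : a < n) (hp : 1 < p)
    {u : EuclideanSpace ℝ (Fin n) → ℝ} (hu : Continuous u)
    (hu0 : ∀ x, 0 ≤ u x)
    (hint : ∀ φ : EuclideanSpace ℝ (Fin n) → ℝ, ContDiff ℝ ∞ φ → HasCompactSupport φ →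
      Integrable (fun x => u x ^ p / ‖x‖ ^ a * φ x))
    (hweak : ∀ φ : EuclideanSpace ℝ (Fin n) → ℝ, ContDiff ℝ ∞ φ → HasCompactSupport φ →
      ∫ x, u x * negLapIter m φ x = ∫ x, u x ^ p / ‖x‖ ^ a * φ x) : ∀ x, u x = 0 := by
  have hne' : Nonempty (Fin n) := ⟨⟨0, by omega⟩⟩
  have hne : ∀ᵐ x : EuclideanSpace ℝ (Fin n), x ≠ 0 := by
    simp [ae_iff]
  let η : ContDiffBump (0 : EuclideanSpace ℝ (Fin n)) := ⟨1, 2, by norm_num, by norm_num⟩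
  have hη : ContDiff ℝ ∞ η := η.contDiff
  obtain ⟨N, hN⟩ := exists_nat_ge ((n : ℝ) / (p - 1) + 1)
  have hNp : ((N + 2 * m : ℕ) : ℝ) * p⁻¹ ≤ N := by
    have hp1 : 0 < p - 1 := by linarith
    have h1 : (n : ℝ) / (p - 1) ≤ N := by linarith
    rw [div_le_iff₀ hp1] at h1
    rw [← hm, ← div_eq_mul_inv, div_le_iff₀ (by linarith)]
    push_cast
    linarith
  have hN0 : N ≠ 0 := by
    rintro rfl
    have : 0 ≤ (n : ℝ) / (p - 1) := div_nonneg (by positivity) (by linarith)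
    norm_num at hN
    linarith
  obtain ⟨g, hg, hgeq⟩ := negLapIter_pow hη m N
  obtain ⟨G', hG'⟩ := (isCompact_closedBall (0 : EuclideanSpace ℝ (Fin n)) 2).exists_bound_of_continuousOn
    hg.continuous.continuousOn
  have hG0 : 0 ≤ |G'| := abs_nonneg _
  have hG : ∀ x ∈ closedBall (0 : EuclideanSpace ℝ (Fin n)) 2, |g x| ≤ |G'| :=
    fun x hx => (hG' x hx).trans (le_abs_self _)
  generalize |G'| = G at hG0 hG
  let φ : ℝ → EuclideanSpace ℝ (Fin n) → ℝ := fun R x => η (R⁻¹ • x) ^ (N + 2 * m)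
  have hφ : ∀ R, ContDiff ℝ ∞ (φ R) := fun R => (hη.comp (contDiff_const_smul _)).pow _
  have hφ0 : ∀ R x, 0 ≤ φ R x := fun R x => pow_nonneg η.nonneg _
  have hφ1 : ∀ R x, φ R x ≤ 1 := fun R x => pow_le_one₀ η.nonneg η.le_one
  have hηz : ∀ R, 0 < R → ∀ x, x ∉ closedBall (0 : EuclideanSpace ℝ (Fin n)) (2 * R) →
      η (R⁻¹ • x) = 0 := by
    intro R hR x hx
    refine η.zero_of_le_dist ?_
    rw [mem_closedBall_zero_iff, not_le] at hx
    rw [dist_zero_right, norm_smul, norm_inv, Real.norm_eq_abs, abs_of_pos hR, inv_mul_eq_div]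
    change (2 : ℝ) ≤ _
    rw [le_div_iff₀ hR]
    exact hx.le
  have hφz : ∀ R, 0 < R → ∀ x, x ∉ closedBall (0 : EuclideanSpace ℝ (Fin n)) (2 * R) →
      φ R x = 0 := by
    intro R hR x hx
    simp only [φ]
    rw [hηz R hR x hx, zero_pow (by omega)]
  have hφone : ∀ R, 0 < R → ∀ x, x ∈ closedBall (0 : EuclideanSpace ℝ (Fin n)) R →
      φ R x = 1 := by
    intro R hR x hx
    have : η (R⁻¹ • x) = 1 := by
      refine η.one_of_mem_closedBall ?_
      rw [mem_closedBall_zero_iff] at hx ⊢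
      rw [norm_smul, norm_inv, Real.norm_eq_abs, abs_of_pos hR, inv_mul_eq_div]
      change _ ≤ (1 : ℝ)
      rwa [div_le_one hR]
    simp only [φ]
    rw [this, one_pow]
  have hφc : ∀ R, 0 < R → HasCompactSupport (φ R) := fun R hR =>
    HasCompactSupport.intro (isCompact_closedBall _ _) (hφz R hR)
  obtain ⟨q, hpq⟩ : ∃ q : ℝ, p.HolderConjugate q := ⟨_, Real.HolderConjugate.conjExponent hp⟩
  have hp0 : 0 < p := by linarith
  have hq0 : 0 < q := hpq.symm.pos
  let B : ℝ → ℝ := fun R => (R ^ (2 * m))⁻¹ * G * (2 * R) ^ (a / p)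
  have hB0 : ∀ R, 0 < R → 0 ≤ B R := fun R hR => by positivity
  -- pointwise Young inequality
  have hpt : ∀ R, 0 < R → ∀ x : EuclideanSpace ℝ (Fin n), x ≠ 0 →
      u x * negLapIter m (φ R) x ≤ (u x ^ p / ‖x‖ ^ a * φ R x) / p +
        (closedBall (0 : EuclideanSpace ℝ (Fin n)) (2 * R)).indicator (fun _ => B R ^ q / q) x := by
    intro R hR x hx
    have hxn : 0 < ‖x‖ := norm_pos_iff.2 hx
    have e1 : negLapIter m (φ R) x = (R⁻¹) ^ (2 * m) * (g (R⁻¹ • x) * η (R⁻¹ • x) ^ N) := by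
      have := congrFun (negLapIter_scale (f := fun x => η x ^ (N + 2 * m)) R⁻¹ m) x
      simp only [hgeq] at this
      exact this
    rw [e1]
    by_cases hxb : x ∈ closedBall (0 : EuclideanSpace ℝ (Fin n)) (2 * R)
    · rw [indicator_of_mem hxb]
      rw [mem_closedBall_zero_iff] at hxb
      have hgx : |g (R⁻¹ • x)| ≤ G := by
        refine hG _ ?_
        rw [mem_closedBall_zero_iff, norm_smul, norm_inv, Real.norm_eq_abs, abs_of_pos hR,
          inv_mul_eq_div, div_le_iff₀ hR]
        exact hxb
      have hy := Real.young_inequality_of_nonneg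
        (a := u x / ‖x‖ ^ (a / p) * φ R x ^ p⁻¹) (b := B R)
        (mul_nonneg (div_nonneg (hu0 x) (by positivity)) (rpow_nonneg (hφ0 R x) _)) (hB0 R hR) hpq
      have e2 : (u x / ‖x‖ ^ (a / p) * φ R x ^ p⁻¹) ^ p = u x ^ p / ‖x‖ ^ a * φ R x := by
        rw [mul_rpow (div_nonneg (hu0 x) (by positivity)) (rpow_nonneg (hφ0 R x) _),
          div_rpow (hu0 x) (by positivity), ← rpow_mul hxn.le, ← rpow_mul (hφ0 R x),
          inv_mul_cancel₀ hp0.ne', div_mul_cancel₀ _ hp0.ne', rpow_one]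
      rw [e2] at hy
      refine le_trans ?_ hy
      have h3 : η (R⁻¹ • x) ^ N ≤ φ R x ^ p⁻¹ := by
        simp only [φ]
        rw [← rpow_natCast _ (N + 2 * m), ← rpow_mul η.nonneg, ← rpow_natCast _ N]
        by_cases h0 : η (R⁻¹ • x) = 0
        · rw [h0, zero_rpow (by exact_mod_cast hN0)]
          exact rpow_nonneg le_rfl _
        · exact rpow_le_rpow_of_exponent_ge (lt_of_le_of_ne η.nonneg (Ne.symm h0)) η.le_one hNp
      have h4 : 1 ≤ (2 * R) ^ (a / p) / ‖x‖ ^ (a / p) := by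
        rw [one_le_div (by positivity)]
        exact rpow_le_rpow hxn.le hxb (by positivity)
      have hη0 : 0 ≤ η (R⁻¹ • x) ^ N := pow_nonneg η.nonneg _
      calc u x * ((R⁻¹) ^ (2 * m) * (g (R⁻¹ • x) * η (R⁻¹ • x) ^ N))
          ≤ u x * ((R⁻¹) ^ (2 * m) * (G * φ R x ^ p⁻¹)) := by
            have := hu0 x
            have h6 : g (R⁻¹ • x) ≤ G := (le_abs_self _).trans hgx
            gcongr
        _ ≤ u x * ((R⁻¹) ^ (2 * m) * (G * φ R x ^ p⁻¹)) * ((2 * R) ^ (a / p) / ‖x‖ ^ (a / p)) := by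
            refine le_mul_of_one_le_right ?_ h4
            have := hu0 x
            have := rpow_nonneg (hφ0 R x) p⁻¹
            positivity
        _ = _ := by
            simp only [B]
            rw [inv_pow]
            ring
    · rw [indicator_of_notMem hxb, hηz R hR x hxb, hφz R hR x hxb, zero_pow hN0]
      simp
  -- integrated estimate
  have hI : ∀ R, 0 < R → ∫ x, u x ^ p / ‖x‖ ^ a * φ R x ≤
      B R ^ q * volume.real (closedBall (0 : EuclideanSpace ℝ (Fin n)) (2 * R)) := by
    intro R hR
    have hi := hint _ (hφ R) (hφc R hR)
    have h1 := hweak _ (hφ R) (hφc R hR)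
    have hii : Integrable ((closedBall (0 : EuclideanSpace ℝ (Fin n)) (2 * R)).indicator
        (fun _ => B R ^ q / q)) :=
      (integrable_indicator_iff measurableSet_closedBall).2
        (integrableOn_const (measure_closedBall_lt_top).ne)
    have h2 : ∫ x, u x * negLapIter m (φ R) x ≤ ∫ x, ((u x ^ p / ‖x‖ ^ a * φ R x) / p +
        (closedBall (0 : EuclideanSpace ℝ (Fin n)) (2 * R)).indicator (fun _ => B R ^ q / q) x) := by
      refine integral_mono_ae ?_ ((hi.div_const p).add hii) ?_
      · exact int_mul isOpen_univ hu.continuousOn (negLapIter_smooth (hφ R) m).continuous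
          (subset_univ _) ((hφc R hR).of_isClosed_subset (isClosed_tsupport _)
            (tsupport_negLapIter _ _))
      · filter_upwards [hne] with x hx using hpt R hR x hx
    rw [integral_add (hi.div_const p) hii, integral_div, integral_indicator_const _
      measurableSet_closedBall, h1, smul_eq_mul] at h2
    have h3 : p⁻¹ + q⁻¹ = 1 := hpq.inv_add_inv_eq_one
    set I := ∫ x, u x ^ p / ‖x‖ ^ a * φ R x
    have h4 : I * q⁻¹ ≤ B R ^ q * volume.real (closedBall (0 : EuclideanSpace ℝ (Fin n)) (2 * R)) * q⁻¹ := by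
      have : q⁻¹ = 1 - p⁻¹ := by linarith
      calc I * q⁻¹ = I - I / p := by rw [this]; ring
        _ ≤ _ := by rw [sub_le_iff_le_add]; calc _ ≤ _ := h2
                    _ = _ := by ring
    exact le_of_mul_le_mul_right h4 (by positivity)
  -- decay of the bound
  have hlim : Tendsto (fun R => B R ^ q *
      volume.real (closedBall (0 : EuclideanSpace ℝ (Fin n)) (2 * R))) atTop (nhds 0) := by
    have hexp : 0 < -((a / p - n) * q + n) := by
      have hq : q = p / (p - 1) := hpq.conjugate_eq
      have hp1 : 0 < p - 1 := by linarith
      have : -((a / p - n) * q + n) = (n - a) / (p - 1) := by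
        rw [hq]; field_simp; ring
      rw [this]
      exact div_pos (by linarith) hp1
    have ht := (tendsto_rpow_neg_atTop hexp).const_mul ((G * 2 ^ (a / p)) ^ q * 2 ^ n *
      volume.real (closedBall (0 : EuclideanSpace ℝ (Fin n)) 1))
    rw [mul_zero] at ht
    refine ht.congr' ?_
    filter_upwards [eventually_gt_atTop 0] with R hR
    rw [Measure.addHaar_real_closedBall' _ _ (by positivity : 0 ≤ 2 * R)]
    simp only [finrank_euclideanSpace, Fintype.card_fin, B]
    rw [← hm, mul_rpow (by norm_num) hR.le]
    have : (R ^ n)⁻¹ * G * (2 ^ (a / p) * R ^ (a / p)) = (G * 2 ^ (a / p)) * R ^ (a / p - n) := by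
      rw [rpow_sub hR, rpow_natCast]
      field_simp
    rw [this, mul_rpow (x := G * 2 ^ (a / p)) (y := R ^ (a / p - n)) (by positivity) (by positivity),
      ← rpow_mul hR.le, neg_neg, rpow_add hR,
      rpow_natCast]
    ring
  -- conclusion
  intro x
  set r : ℝ := ‖x‖ + 1 with hr
  have hr0 : 0 < r := by positivity
  have hf0 : ∀ y, 0 ≤ u y ^ p / ‖y‖ ^ a := fun y =>
    div_nonneg (rpow_nonneg (hu0 y) _) (by positivity)
  have hle : ∫ y, u y ^ p / ‖y‖ ^ a * φ r y ≤ 0 := by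
    refine ge_of_tendsto hlim ?_
    filter_upwards [eventually_ge_atTop (2 * r)] with R hR
    have hR0 : 0 < R := by linarith
    refine le_trans ?_ (hI R hR0)
    refine integral_mono (hint _ (hφ r) (hφc r hr0)) (hint _ (hφ R) (hφc R hR0)) fun y => ?_
    refine mul_le_mul_of_nonneg_left ?_ (hf0 y)
    by_cases hy : y ∈ closedBall (0 : EuclideanSpace ℝ (Fin n)) (2 * r)
    · rw [hφone R hR0 y (closedBall_subset_closedBall hR hy)]
      exact hφ1 _ _
    · rw [hφz r hr0 y hy]
      exact hφ0 _ _
  have hnn : ∀ y, 0 ≤ u y ^ p / ‖y‖ ^ a * φ r y := fun y => mul_nonneg (hf0 y) (hφ0 _ _)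
  have hz := (integral_eq_zero_iff_of_nonneg hnn (hint _ (hφ r) (hφc r hr0))).1
    (le_antisymm hle (integral_nonneg hnn))
  have hae : (fun y => u y * φ r y) =ᵐ[volume] fun _ => 0 := by
    filter_upwards [hz, hne] with y hy hy0
    have hyn : 0 < ‖y‖ := norm_pos_iff.2 hy0
    rcases mul_eq_zero.1 hy with h | h
    · rw [div_eq_zero_iff] at h
      rcases h with h | h
      · rw [(rpow_eq_zero (hu0 y) hp0.ne').1 h, zero_mul]
      · exact absurd h (by positivity)
    · rw [h, mul_zero]
  have hall := (Continuous.ae_eq_iff_eq volume (hu.mul (hφ r).continuous) continuous_const).1 hae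
  have := congrFun hall x
  change u x * φ r x = 0 at this
  rw [hφone r hr0 x (by rw [mem_closedBall_zero_iff]; linarith), mul_one] at this
  exact this

end Helpers

theorem super_polyharmonic_property
    (n : ℕ) (hn4 : 4 ≤ n) (hne : Even n) (a p : ℝ)
    (ha0 : 0 ≤ a) (han : a < n) (hp : 1 < p)
    (u : EuclideanSpace ℝ (Fin n) → ℝ)
    (hu0 : ∀ x, 0 ≤ u x)
    (hreg0 : a = 0 → ContDiff ℝ n u)
    (hreg1 : 0 < a → ContDiffOn ℝ n u {(0 : EuclideanSpace ℝ (Fin n))}ᶜ ∧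
      ContDiff ℝ (n - 2 : ℕ) u)
    (heq : ∀ x : EuclideanSpace ℝ (Fin n), x ≠ 0 →
      negLapIter (n / 2) u x = u x ^ p / ‖x‖ ^ a)
    (heq0 : a = 0 → negLapIter (n / 2) u 0 = u 0 ^ p / ‖(0 : EuclideanSpace ℝ (Fin n))‖ ^ a)
    (hcond : a ≤ 2 + 2 * p ∨
      u =o[cocompact (EuclideanSpace ℝ (Fin n))] fun x => ‖x‖ ^ 2) :
    ∀ i : ℕ, 1 ≤ i → i ≤ n / 2 - 1 → ∀ x, 0 ≤ negLapIter i u x := by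
  have hreg : ContDiffOn ℝ n u {(0 : EuclideanSpace ℝ (Fin n))}ᶜ ∧ ContDiff ℝ (n - 2 : ℕ) u := by
    rcases ha0.eq_or_lt with h | h
    · have := hreg0 h.symm
      exact ⟨this.contDiffOn, this.of_le (by norm_cast; omega)⟩
    · exact hreg1 h
  obtain ⟨hr1, hr2⟩ := hreg
  obtain ⟨M, hM⟩ : ∃ M, n = 2 * (M + 1) := by
    obtain ⟨k, hk⟩ := hne
    exact ⟨k - 1, by omega⟩
  have hdiv : n / 2 = M + 1 := by omega
  rw [hdiv] at heq
  have hu : Continuous u := hr2.continuous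
  have hint : ∀ φ : EuclideanSpace ℝ (Fin n) → ℝ, Continuous φ → HasCompactSupport φ →
      Integrable (fun x => u x ^ p / ‖x‖ ^ a * φ x) := by
    intro φ hφ hc
    have hloc : LocallyIntegrable (fun x : EuclideanSpace ℝ (Fin n) => ‖x‖ ^ (-a)) volume := by
      refine locallyIntegrable_of_norm_le_rpow (C := 1) (α := a) ?_ ?_ ?_ ?_
      · simp; omega
      · simpa using han
      · refine Eventually.of_forall fun x => ?_
        rw [Real.norm_eq_abs, abs_of_nonneg (by positivity), one_mul]
      · exact (measurable_norm.pow_const _).aestronglyMeasurable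
    have hcont : Continuous (fun x => u x ^ p * φ x) :=
      (hu.rpow_const fun x => Or.inr (by linarith)).mul hφ
    have := hloc.integrable_smul_right_of_hasCompactSupport hcont hc.mul_left
    refine this.congr (Eventually.of_forall fun x => ?_)
    simp only [smul_eq_mul]
    rw [rpow_neg (norm_nonneg x)]
    ring
  have hzero : ∀ x, u x = 0 := by
    refine u_eq_zero (by omega) hM ha0 han hp hu hu0 (fun φ h1 h2 => hint φ h1.continuous h2) ?_
    intro φ hφ hc
    have hA := weakA (M := M) (hr2.of_le (by norm_cast; omega)) hφ hc M 1 le_rfl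
    rw [add_comm 1 M] at hA
    rw [hA]
    have e1 : negLapIter 1 φ = fun x => -laplacian φ x := rfl
    rw [e1]
    refine weakB (by omega) ?_ ?_ ?_ hφ hc (hint φ hφ.continuous hc)
    · have := negLapIter_contDiffOn (f := u) isOpen_univ M (k := 0)
        ((hr2.of_le (by norm_cast; omega)).contDiffOn)
      exact continuousOn_univ.1 this.continuousOn
    · have := negLapIter_contDiffOn (f := u)
        (isOpen_compl_singleton (x := (0 : EuclideanSpace ℝ (Fin n)))) M (k := 2)
        (hr1.of_le (by norm_cast; omega))
      simpa using this
    · intro x hx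
      rw [← heq x hx, negLapIter_succ]
  intro i _ _ x
  have : u = fun _ => 0 := funext hzero
  rw [this, negLapIter_zero]
end

section
/- Suppose u is harmonic in B_R(0) \ {0} ⊂ ℝ^n with n ≥ 3 and u(x) = o(|x|^{2-n}) as |x| → 0. Then u extends to a function harmonic on all of B_R(0) (removable singularity). -/
open MeasureTheory Filter Asymptotics Metric Set Real Topology

namespace RS

theorem lap_congr {n : ℕ} {f g : EuclideanSpace ℝ (Fin n) → ℝ} {x : EuclideanSpace ℝ (Fin n)}
    (h : f =ᶠ[𝓝 x] g) : laplacian f x = laplacian g x := by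
  unfold laplacian
  refine Finset.sum_congr rfl fun i _ => ?_
  have h1 : (fun y => fderiv ℝ f y (EuclideanSpace.single i 1)) =ᶠ[𝓝 x]
      (fun y => fderiv ℝ g y (EuclideanSpace.single i 1)) := by
    filter_upwards [h.fderiv (𝕜 := ℝ)] with y hy
    rw [hy]
  rw [h1.fderiv_eq]

theorem pd_contDiff {n : ℕ} {f : EuclideanSpace ℝ (Fin n) → ℝ} (hf : ContDiff ℝ 2 f)
    (e : EuclideanSpace ℝ (Fin n)) : ContDiff ℝ 1 (fun y => fderiv ℝ f y e) :=
  (hf.fderiv_right (m := 1) (by norm_num)).clm_apply contDiff_const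

theorem lap_cont {n : ℕ} {f : EuclideanSpace ℝ (Fin n) → ℝ} (hf : ContDiff ℝ 2 f) :
    Continuous (laplacian f) := by
  unfold laplacian
  refine continuous_finsetSum _ fun i _ => ?_
  exact ((pd_contDiff hf _).continuous_fderiv (by norm_num)).clm_apply continuous_const

theorem lap_add {n : ℕ} {f g : EuclideanSpace ℝ (Fin n) → ℝ} (hf : ContDiff ℝ 2 f)
    (hg : ContDiff ℝ 2 g) (x : EuclideanSpace ℝ (Fin n)) :
    laplacian (fun y => f y + g y) x = laplacian f x + laplacian g x := by
  unfold laplacian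
  rw [← Finset.sum_add_distrib]
  refine Finset.sum_congr rfl fun i _ => ?_
  have h1 : (fun y => fderiv ℝ (fun y => f y + g y) y (EuclideanSpace.single i 1)) =
      fun y => fderiv ℝ f y (EuclideanSpace.single i 1) +
        fderiv ℝ g y (EuclideanSpace.single i 1) := by
    funext y
    rw [fderiv_fun_add (hf.differentiable (by norm_num) y) (hg.differentiable (by norm_num) y)]
    rfl
  rw [h1, fderiv_fun_add ((pd_contDiff hf _).differentiable (by norm_num) x)
    ((pd_contDiff hg _).differentiable (by norm_num) x)]
  rfl

theorem lap_le {n : ℕ} {f : EuclideanSpace ℝ (Fin n) → ℝ} (hf : ContDiff ℝ 2 f)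
    (x : EuclideanSpace ℝ (Fin n)) :
    |laplacian f x| ≤ n * ‖iteratedFDeriv ℝ 2 f x‖ := by
  unfold laplacian
  refine (Finset.abs_sum_le_sum_abs _ _).trans ?_
  calc _ ≤ ∑ i : Fin n, ‖iteratedFDeriv ℝ 2 f x‖ := ?_
    _ = _ := by simp
  refine Finset.sum_le_sum fun i _ => ?_
  have h1 : fderiv ℝ (fun y => fderiv ℝ f y (EuclideanSpace.single i 1)) x
      (EuclideanSpace.single i 1) =
      iteratedFDeriv ℝ 2 f x ![EuclideanSpace.single i 1, EuclideanSpace.single i 1] := by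
    rw [iteratedFDeriv_two_apply]
    rw [fderiv_clm_apply ((hf.fderiv_right (m := 1) (by norm_num)).differentiable (by norm_num) x)
      (differentiableAt_const _)]
    simp
  rw [h1, ← Real.norm_eq_abs]
  refine (ContinuousMultilinearMap.le_opNorm _ _).trans ?_
  simp [Fin.prod_univ_two]

/-- Laplacian under affine change of variables. -/
theorem lap_affine {n : ℕ} {f : EuclideanSpace ℝ (Fin n) → ℝ} (hf : ContDiff ℝ 2 f) (a : ℝ)
    (x y : EuclideanSpace ℝ (Fin n)) :
    laplacian (fun y => f (a • (x - y))) y = a ^ 2 * laplacian f (a • (x - y)) := by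
  have key : ∀ (g : EuclideanSpace ℝ (Fin n) → ℝ) (_ : Differentiable ℝ g)
      (e z : EuclideanSpace ℝ (Fin n)),
      fderiv ℝ (fun y => g (a • (x - y))) z e = -a * fderiv ℝ g (a • (x - z)) e := by
    intro g hg e z
    have h1 : HasFDerivAt (fun y => a • (x - y))
        (a • (-(ContinuousLinearMap.id ℝ (EuclideanSpace ℝ (Fin n))))) z := by
      have := ((hasFDerivAt_id (𝕜 := ℝ) z).const_sub x).const_smul a
      exact this
    have h2 := ((hg (a • (x - z))).hasFDerivAt).comp z h1
    have h3 : fderiv ℝ (fun y => g (a • (x - y))) z = _ := h2.fderiv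
    rw [h3]
    simp
  unfold laplacian
  rw [Finset.mul_sum]
  refine Finset.sum_congr rfl fun i _ => ?_
  have h1 : (fun y => fderiv ℝ (fun y => f (a • (x - y))) y (EuclideanSpace.single i 1)) =
      fun y => (fun w => -a * fderiv ℝ f w (EuclideanSpace.single i 1)) (a • (x - y)) := by
    funext z
    exact key f (hf.differentiable (by norm_num)) _ _
  rw [h1, key _ (((pd_contDiff hf _).differentiable (by norm_num)).const_mul _),
    fderiv_const_mul ((pd_contDiff hf _).differentiable (by norm_num) _)]
  simp
  ring

theorem mul_integrable {n : ℕ} {U : Set (EuclideanSpace ℝ (Fin n))} (hU : IsOpen U)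
    {w g : EuclideanSpace ℝ (Fin n) → ℝ} (hw : ContinuousOn w U) (hg : Continuous g)
    (hc : HasCompactSupport g) (hs : tsupport g ⊆ U) : Integrable (fun x => w x * g x) := by
  have h1 : Continuous (fun x => w x * g x) := by
    rw [continuous_iff_continuousAt]
    intro x
    by_cases hx : x ∈ tsupport g
    · exact (hw.continuousAt (hU.mem_nhds (hs hx))).mul hg.continuousAt
    · have : (fun x => w x * g x) =ᶠ[𝓝 x] fun _ => 0 := by
        filter_upwards [(isClosed_tsupport g).isOpen_compl.mem_nhds hx] with y hy
        rw [image_eq_zero_of_notMem_tsupport hy, mul_zero]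
      exact continuousAt_const.congr this.symm
  exact h1.integrable_of_hasCompactSupport hc.mul_left

/-- Green's identity: harmonic on an open set is weakly harmonic. -/
theorem green {n : ℕ} {U : Set (EuclideanSpace ℝ (Fin n))} (hU : IsOpen U)
    {u φ : EuclideanSpace ℝ (Fin n) → ℝ} (hu : ContDiffOn ℝ 2 u U)
    (hharm : ∀ x ∈ U, laplacian u x = 0) (hφ : ContDiff ℝ 2 φ)
    (hc : HasCompactSupport φ) (hs : tsupport φ ⊆ U) :
    ∫ x, u x * laplacian φ x = 0 := by
  have hu1 : ∀ e, ContDiffOn ℝ 1 (fun y => fderiv ℝ u y e) U := fun e =>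
    (hu.fderiv_of_isOpen hU (m := 1) (by norm_num)).clm_apply contDiffOn_const
  have hu2 : ∀ e, ContinuousOn (fun x => fderiv ℝ (fun y => fderiv ℝ u y e) x e) U := fun e =>
    ((hu1 e).continuousOn_fderiv_of_isOpen hU (by norm_num)).clm_apply continuousOn_const
  have hc1 : ∀ e, HasCompactSupport (fun y => fderiv ℝ φ y e) := fun e => hc.fderiv_apply ℝ e
  have hs1 : ∀ e, tsupport (fun y => fderiv ℝ φ y e) ⊆ tsupport φ := fun e =>
    tsupport_fderiv_apply_subset ℝ e
  have hc2 : ∀ e, HasCompactSupport (fun x => fderiv ℝ (fun y => fderiv ℝ φ y e) x e) :=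
    fun e => (hc1 e).fderiv_apply ℝ e
  have hs2 : ∀ e, tsupport (fun x => fderiv ℝ (fun y => fderiv ℝ φ y e) x e) ⊆ tsupport φ :=
    fun e => (tsupport_fderiv_apply_subset ℝ e).trans (hs1 e)
  have hφ1 := fun e => pd_contDiff hφ e
  have hφ2 : ∀ e, Continuous (fun x => fderiv ℝ (fun y => fderiv ℝ φ y e) x e) := fun e =>
    ((hφ1 e).continuous_fderiv (by norm_num)).clm_apply continuous_const
  have i1 : ∀ e, Integrable (fun x => u x * fderiv ℝ (fun y => fderiv ℝ φ y e) x e) := fun e =>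
    mul_integrable hU hu.continuousOn (hφ2 e) (hc2 e) ((hs2 e).trans hs)
  have i2 : ∀ e, Integrable (fun x => u x * fderiv ℝ φ x e) := fun e =>
    mul_integrable hU hu.continuousOn (hφ1 e).continuous (hc1 e) ((hs1 e).trans hs)
  have i3 : ∀ e, Integrable (fun x => fderiv ℝ u x e * fderiv ℝ φ x e) := fun e =>
    mul_integrable hU (hu1 e).continuousOn (hφ1 e).continuous (hc1 e) ((hs1 e).trans hs)
  have i4 : ∀ e, Integrable (fun x => fderiv ℝ u x e * φ x) := fun e =>
    mul_integrable hU (hu1 e).continuousOn hφ.continuous hc hs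
  have i5 : ∀ e, Integrable (fun x => fderiv ℝ (fun y => fderiv ℝ u y e) x e * φ x) := fun e =>
    mul_integrable hU (hu2 e) hφ.continuous hc hs
  have key : ∀ e, ∫ x, u x * fderiv ℝ (fun y => fderiv ℝ φ y e) x e =
      ∫ x, fderiv ℝ (fun y => fderiv ℝ u y e) x e * φ x := by
    intro e
    have A := integral_mul_fderiv_eq_neg_fderiv_mul_of_integrable (μ := volume) (i3 e) (i1 e) (i2 e)
      (fun x hx => (hu.contDiffAt (hU.mem_nhds (hs (hs1 e hx)))).differentiableAt (by norm_num))
      (fun x _ => (hφ1 e).differentiable (by norm_num) x)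
    have B := integral_mul_fderiv_eq_neg_fderiv_mul_of_integrable (μ := volume) (i5 e) (i3 e) (i4 e)
      (fun x hx => ((hu1 e).contDiffAt (hU.mem_nhds (hs hx))).differentiableAt (by norm_num))
      (fun x _ => hφ.differentiable (by norm_num) x)
    rw [A, B, neg_neg]
  unfold laplacian
  simp_rw [Finset.mul_sum]
  rw [integral_finsetSum _ fun i _ => i1 _]
  simp_rw [key]
  rw [← integral_finsetSum _ fun i _ => i5 _]
  simp_rw [← Finset.sum_mul]
  refine integral_eq_zero_of_ae (Eventually.of_forall fun x => ?_)
  by_cases hx : x ∈ tsupport φ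
  · have := hharm x (hs hx)
    unfold laplacian at this
    simp [this]
  · simp [image_eq_zero_of_notMem_tsupport hx]

theorem pow_int {n : ℕ} (hn : 3 ≤ n) (ρ : ℝ) :
    IntegrableOn (fun x : EuclideanSpace ℝ (Fin n) => ‖x‖ ^ ((2 : ℝ) - n)) (ball 0 ρ) := by
  have : Nonempty (Fin n) := ⟨⟨0, by omega⟩⟩
  rw [integrableOn_fun_norm_addHaar volume (f := fun t => t ^ ((2 : ℝ) - n))]
  have h1 : IntegrableOn (fun y : ℝ => y) (Ioo 0 ρ) :=
    (continuous_id.integrableOn_Icc (a := 0) (b := ρ)).mono_set Ioo_subset_Icc_self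
  refine h1.congr_fun (fun y hy => ?_) measurableSet_Ioo
  simp only [finrank_euclideanSpace, Fintype.card_fin, smul_eq_mul]
  rw [← Real.rpow_natCast, ← Real.rpow_add hy.1, Nat.cast_sub (by omega)]
  have : ((n : ℝ) - (1 : ℕ) + (2 - n)) = 1 := by push_cast; ring
  rw [this, Real.rpow_one]

theorem pow_mass {n : ℕ} (hn : 3 ≤ n) : ∃ C : ℝ, 0 ≤ C ∧ ∀ ρ : ℝ, 0 < ρ →
    ∫ x in ball (0 : EuclideanSpace ℝ (Fin n)) ρ, ‖x‖ ^ ((2 : ℝ) - n) = C * ρ ^ 2 := by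
  have : Nonempty (Fin n) := ⟨⟨0, by omega⟩⟩
  refine ⟨n * (volume.real (ball (0 : EuclideanSpace ℝ (Fin n)) 1) * (1 / 2)), by positivity,
    fun ρ hρ => ?_⟩
  rw [← integral_indicator measurableSet_ball]
  have h0 : (indicator (ball (0 : EuclideanSpace ℝ (Fin n)) ρ)
      (fun x => ‖x‖ ^ ((2 : ℝ) - n))) =
      fun x => (Iio ρ).indicator (fun t : ℝ => t ^ ((2 : ℝ) - n)) ‖x‖ := by
    funext x
    simp [indicator]
  rw [h0, integral_fun_norm_addHaar volume]
  have h1 : ∫ y in Ioi (0 : ℝ), y ^ (Module.finrank ℝ (EuclideanSpace ℝ (Fin n)) - 1) •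
      (Iio ρ).indicator (fun t : ℝ => t ^ ((2 : ℝ) - n)) y = ∫ y in (0 : ℝ)..ρ, y := by
    rw [intervalIntegral.integral_of_le hρ.le, integral_Ioc_eq_integral_Ioo,
      ← integral_indicator measurableSet_Ioo, ← integral_indicator measurableSet_Ioi]
    congr 1
    funext y
    by_cases hy : 0 < y
    · by_cases hy2 : y < ρ
      · simp only [indicator, mem_Ioi, hy, mem_Iio, hy2, mem_Ioo, if_true, and_self]
        simp only [finrank_euclideanSpace, Fintype.card_fin, smul_eq_mul]
        rw [← Real.rpow_natCast, ← Real.rpow_add hy, Nat.cast_sub (by omega)]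
        have : ((n : ℝ) - (1 : ℕ) + (2 - n)) = 1 := by push_cast; ring
        rw [this, Real.rpow_one]
      · simp [indicator, hy2]
    · simp [indicator, hy]
  rw [h1, integral_id]
  simp
  ring

theorem bd {n : ℕ} (hn : 3 ≤ n) {u : EuclideanSpace ℝ (Fin n) → ℝ}
    (hlittle : u =o[𝓝[≠] (0 : EuclideanSpace ℝ (Fin n))] fun x => ‖x‖ ^ ((2 : ℝ) - n))
    {κ : ℝ} (hκ : 0 < κ) : ∃ ρ > 0, ∀ x ∈ ball (0 : EuclideanSpace ℝ (Fin n)) ρ \ {0},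
      |u x| ≤ κ * ‖x‖ ^ ((2 : ℝ) - n) := by
  have h := hlittle.def hκ
  rw [eventually_nhdsWithin_iff, Metric.eventually_nhds_iff_ball] at h
  obtain ⟨ρ, hρ, h⟩ := h
  refine ⟨ρ, hρ, fun x hx => ?_⟩
  have := h x hx.1 hx.2
  rwa [Real.norm_eq_abs, Real.norm_of_nonneg (by positivity)] at this

theorem f_int {n : ℕ} (hn : 3 ≤ n) {R : ℝ} (hR : 0 < R) {u : EuclideanSpace ℝ (Fin n) → ℝ}
    (hu : ContinuousOn u (ball (0 : EuclideanSpace ℝ (Fin n)) R \ {0}))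
    (hlittle : u =o[𝓝[≠] (0 : EuclideanSpace ℝ (Fin n))] fun x => ‖x‖ ^ ((2 : ℝ) - n)) :
    Integrable (indicator (ball (0 : EuclideanSpace ℝ (Fin n)) (R / 2) \ {0}) u) := by
  obtain ⟨ρ, hρ, hb⟩ := bd hn hlittle one_pos
  have hm : MeasurableSet (ball (0 : EuclideanSpace ℝ (Fin n)) (R / 2) \ {0}) :=
    measurableSet_ball.diff (measurableSet_singleton _)
  rw [integrable_indicator_iff hm]
  set A := (ball (0 : EuclideanSpace ℝ (Fin n)) (min ρ R) \ {0}) with hA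
  have hAm : MeasurableSet A := measurableSet_ball.diff (measurableSet_singleton _)
  have h1 : IntegrableOn u A := by
    have hp := (pow_int hn (min ρ R)).mono_set (s := A) sdiff_subset
    refine Integrable.mono' hp ?_ ?_
    · refine (hu.mono ?_).aestronglyMeasurable hAm
      exact sdiff_subset_sdiff_left (ball_subset_ball (min_le_right _ _))
    · rw [ae_restrict_iff' hAm]
      refine Eventually.of_forall fun x hx => ?_
      have := hb x ⟨ball_subset_ball (min_le_left _ _) hx.1, hx.2⟩
      simpa using this
  have h2 : IntegrableOn u (closedBall (0 : EuclideanSpace ℝ (Fin n)) (R / 2) \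
      ball 0 (min ρ R)) := by
    refine ContinuousOn.integrableOn_compact ?_ (hu.mono ?_)
    · exact (isCompact_closedBall _ _).diff isOpen_ball
    · rintro x ⟨hx1, hx2⟩
      refine ⟨closedBall_subset_ball (by linarith) hx1, ?_⟩
      rintro rfl
      exact hx2 (mem_ball_self (lt_min hρ hR))
  refine (h1.union h2).mono_set ?_
  rintro x ⟨hx1, hx2⟩
  by_cases hx : x ∈ ball (0 : EuclideanSpace ℝ (Fin n)) (min ρ R)
  · exact Or.inl ⟨hx, hx2⟩
  · exact Or.inr ⟨ball_subset_closedBall hx1, hx⟩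

theorem iter_bd {n : ℕ} {f : EuclideanSpace ℝ (Fin n) → ℝ} (hf : ContDiff ℝ 2 f)
    (hc : HasCompactSupport f) : ∃ M : ℝ, 0 ≤ M ∧ ∀ i ≤ 2, ∀ x, ‖iteratedFDeriv ℝ i f x‖ ≤ M := by
  have h : ∀ i : ℕ, i ≤ 2 → ∃ M : ℝ, ∀ x, ‖iteratedFDeriv ℝ i f x‖ ≤ M := by
    intro i hi
    exact (hc.iteratedFDeriv i).exists_bound_of_continuous
      (hf.continuous_iteratedFDeriv (by exact_mod_cast hi))
  obtain ⟨M0, h0⟩ := h 0 (by norm_num)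
  obtain ⟨M1, h1⟩ := h 1 (by norm_num)
  obtain ⟨M2, h2⟩ := h 2 (by norm_num)
  refine ⟨max M0 (max M1 M2), le_max_of_le_left ((norm_nonneg _).trans (h0 0)), ?_⟩
  intro i hi x
  interval_cases i
  · exact (h0 x).trans (le_max_left _ _)
  · exact (h1 x).trans ((le_max_left _ _).trans (le_max_right _ _))
  · exact (h2 x).trans ((le_max_right _ _).trans (le_max_right _ _))

theorem cut_bd {n : ℕ} {η ψ : EuclideanSpace ℝ (Fin n) → ℝ} (hη : ContDiff ℝ 2 η)
    (hηc : HasCompactSupport η) (hψ : ContDiff ℝ 2 ψ) (hψc : HasCompactSupport ψ) :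
    ∃ B : ℝ, 0 ≤ B ∧ ∀ a : ℝ, 1 ≤ a → ∀ x,
      |laplacian (fun y => η (a • y) * ψ y) x| ≤ B * a ^ 2 := by
  obtain ⟨M, hM0, hM⟩ := iter_bd hη hηc
  obtain ⟨N, hN0, hN⟩ := iter_bd hψ hψc
  refine ⟨n * (4 * (M * N)), by positivity, fun a ha x => ?_⟩
  have hηa : ContDiff ℝ 2 (fun y => η (a • y)) := hη.comp (contDiff_const_smul a)
  refine (lap_le (hηa.mul hψ) x).trans ?_
  rw [mul_assoc]
  refine mul_le_mul_of_nonneg_left ?_ (Nat.cast_nonneg n)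
  refine (norm_iteratedFDeriv_mul_le hηa hψ x (n := 2) (by norm_num)).trans ?_
  have hb : ∀ i ≤ 2, ‖iteratedFDeriv ℝ i (fun y => η (a • y)) x‖ ≤ a ^ 2 * M := by
    intro i hi
    rw [iteratedFDeriv_comp_const_smul a (hη.of_le (by exact_mod_cast hi))]
    rw [norm_smul, norm_pow, Real.norm_of_nonneg (by linarith)]
    exact mul_le_mul (pow_le_pow_right₀ ha hi) (hM i hi _) (norm_nonneg _) (by positivity)
  have hb2 : ∀ i ≤ 2, ‖iteratedFDeriv ℝ i (fun y => η (a • y)) x‖ *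
      ‖iteratedFDeriv ℝ (2 - i) ψ x‖ ≤ a ^ 2 * M * N := fun i hi =>
    mul_le_mul (hb i hi) (hN _ (by omega) x) (norm_nonneg _) (by positivity)
  have e0 := hb2 0 (by norm_num)
  have e1 := hb2 1 (by norm_num)
  have e2 := hb2 2 (by norm_num)
  simp only [Finset.sum_range_succ, Finset.sum_range_zero, Nat.choose, mul_assoc] at *
  norm_num at *
  linarith

theorem weak {n : ℕ} (hn : 3 ≤ n) {R : ℝ} (hR : 0 < R) {u : EuclideanSpace ℝ (Fin n) → ℝ}
    (hreg : ContDiffOn ℝ 2 u (ball (0 : EuclideanSpace ℝ (Fin n)) R \ {0}))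
    (hharm : ∀ x ∈ ball (0 : EuclideanSpace ℝ (Fin n)) R \ {0}, laplacian u x = 0)
    (hlittle : u =o[𝓝[≠] (0 : EuclideanSpace ℝ (Fin n))] fun x => ‖x‖ ^ ((2 : ℝ) - n))
    {ψ : EuclideanSpace ℝ (Fin n) → ℝ} (hψ : ContDiff ℝ 2 ψ) (hψc : HasCompactSupport ψ)
    (hs : tsupport ψ ⊆ ball 0 (R / 2)) :
    ∫ x, indicator (ball (0 : EuclideanSpace ℝ (Fin n)) (R / 2) \ {0}) u x *
      laplacian ψ x = 0 := by
  set U := (ball (0 : EuclideanSpace ℝ (Fin n)) (R / 2) \ {0}) with hU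
  have hUo : IsOpen U := isOpen_ball.sdiff isClosed_singleton
  have hUm : MeasurableSet U := hUo.measurableSet
  have hUR : U ⊆ ball (0 : EuclideanSpace ℝ (Fin n)) R \ {0} :=
    sdiff_subset_sdiff_left (ball_subset_ball (by linarith))
  have hfi := f_int hn hR hreg.continuousOn hlittle
  rw [← hU] at hfi
  let b : ContDiffBump (0 : EuclideanSpace ℝ (Fin n)) := ⟨1, 2, by norm_num, by norm_num⟩
  have hη : ContDiff ℝ 2 (b : EuclideanSpace ℝ (Fin n) → ℝ) := b.contDiff
  have hηc : HasCompactSupport (b : EuclideanSpace ℝ (Fin n) → ℝ) := b.hasCompactSupport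
  obtain ⟨B, hB0, hB⟩ := cut_bd hη hηc hψ hψc
  obtain ⟨C, hC0, hC⟩ := pow_mass hn
  have lapsupp : ∀ φ : EuclideanSpace ℝ (Fin n) → ℝ, ∀ x, x ∉ tsupport φ →
      laplacian φ x = 0 := by
    intro φ x hx
    have : φ =ᶠ[𝓝 x] fun _ => 0 := by
      filter_upwards [(isClosed_tsupport φ).isOpen_compl.mem_nhds hx] with y hy
      exact image_eq_zero_of_notMem_tsupport hy
    rw [lap_congr this]
    simp [laplacian]
  have main : ∀ κ : ℝ, 0 < κ →
      |∫ x, indicator U u x * laplacian ψ x| ≤ κ * (B * C * 9) := by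
    intro κ hκ
    obtain ⟨ρ, hρ, hb⟩ := bd hn hlittle hκ
    -- scale
    obtain ⟨a, ha1, haρ⟩ : ∃ a : ℝ, 1 ≤ a ∧ 3 / a ≤ ρ := by
      refine ⟨max 1 (3 / ρ), le_max_left _ _, ?_⟩
      rw [div_le_iff₀ (by positivity)]
      calc 3 = ρ * (3 / ρ) := by field_simp
        _ ≤ _ := by gcongr; exact le_max_right _ _
    have ha0 : 0 < a := by linarith
    set ψ1 : EuclideanSpace ℝ (Fin n) → ℝ := fun y => b (a • y) * ψ y with hψ1
    set ψ2 : EuclideanSpace ℝ (Fin n) → ℝ := fun y => (1 - b (a • y)) * ψ y with hψ2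
    have hηa : ContDiff ℝ 2 (fun y : EuclideanSpace ℝ (Fin n) => b (a • y)) :=
      hη.comp (contDiff_const_smul a)
    have c1 : ContDiff ℝ 2 ψ1 := hηa.mul hψ
    have c2 : ContDiff ℝ 2 ψ2 := (contDiff_const.sub hηa).mul hψ
    have s1 : HasCompactSupport ψ1 := hψc.mul_left
    have s2 : HasCompactSupport ψ2 := hψc.mul_left
    have hsum : ∀ x, laplacian ψ x = laplacian ψ1 x + laplacian ψ2 x := by
      intro x
      rw [← lap_add c1 c2]
      congr 1
      funext y
      simp only [hψ1, hψ2]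
      ring
    have bdd : ∀ φ : EuclideanSpace ℝ (Fin n) → ℝ, ContDiff ℝ 2 φ → HasCompactSupport φ →
        Integrable (fun x => indicator U u x * laplacian φ x) := by
      intro φ hφ hφc
      obtain ⟨M, hM0, hM⟩ := iter_bd hφ hφc
      refine hfi.mul_bdd (c := n * M) (lap_cont hφ).aestronglyMeasurable
        (Eventually.of_forall fun x => ?_)
      refine (lap_le hφ x).trans ?_
      gcongr
      exact hM 2 le_rfl x
    have I2 : ∫ x, indicator U u x * laplacian ψ2 x = 0 := by
      have t2 : tsupport ψ2 ⊆ U := by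
        intro x hx
        refine ⟨hs (tsupport_mul_subset_right hx), ?_⟩
        rintro rfl
        refine (notMem_tsupport_iff_eventuallyEq.mpr ?_) hx
        filter_upwards [ball_mem_nhds (0 : EuclideanSpace ℝ (Fin n)) (inv_pos.mpr ha0)] with y hy
        have : b (a • y) = 1 := by
          apply b.one_of_mem_closedBall
          rw [mem_closedBall_zero_iff, norm_smul, Real.norm_of_nonneg ha0.le]
          rw [mem_ball_zero_iff] at hy
          calc a * ‖y‖ ≤ a * a⁻¹ := by gcongr
            _ = 1 := mul_inv_cancel₀ ha0.ne'
        simp [hψ2, this]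
      rw [← green hUo (hreg.mono hUR) (fun x hx => hharm x (hUR hx)) c2 s2 t2]
      congr 1
      funext x
      by_cases hx : x ∈ U
      · rw [indicator_of_mem hx]
      · rw [lapsupp ψ2 x (fun h => hx (t2 h)), mul_zero, mul_zero]
    simp_rw [hsum, mul_add]
    rw [integral_add (bdd _ c1 s1) (bdd _ c2 s2), I2, add_zero]
    have hpi : Integrable (indicator (ball (0 : EuclideanSpace ℝ (Fin n)) (3 / a))
        (fun x => ‖x‖ ^ ((2 : ℝ) - n))) :=
      (integrable_indicator_iff measurableSet_ball).mpr (pow_int hn _)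
    calc |∫ x, indicator U u x * laplacian ψ1 x|
        ≤ ∫ x, κ * (B * a ^ 2) * indicator (ball (0 : EuclideanSpace ℝ (Fin n)) (3 / a))
          (fun x => ‖x‖ ^ ((2 : ℝ) - n)) x := by
          rw [← Real.norm_eq_abs]
          refine norm_integral_le_of_norm_le (hpi.const_mul _) (Eventually.of_forall fun x => ?_)
          rw [Real.norm_eq_abs, abs_mul]
          by_cases hx : x ∈ ball (0 : EuclideanSpace ℝ (Fin n)) (3 / a)
          · rw [indicator_of_mem hx]
            have h1 : |indicator U u x| ≤ κ * ‖x‖ ^ ((2 : ℝ) - n) := by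
              by_cases hxU : x ∈ U
              · rw [indicator_of_mem hxU]
                exact hb x ⟨ball_subset_ball haρ hx, hxU.2⟩
              · rw [indicator_of_notMem hxU, abs_zero]
                positivity
            calc _ ≤ (κ * ‖x‖ ^ ((2 : ℝ) - n)) * (B * a ^ 2) :=
                  mul_le_mul h1 (hB a ha1 x) (abs_nonneg _) (by positivity)
              _ = _ := by ring
          · rw [indicator_of_notMem hx, lapsupp ψ1 x, abs_zero, mul_zero, mul_zero]
            refine notMem_tsupport_iff_eventuallyEq.mpr ?_
            have hx' : 2 / a < ‖x‖ := by
              rw [mem_ball_zero_iff, not_lt] at hx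
              refine lt_of_lt_of_le ?_ hx
              gcongr
              norm_num
            filter_upwards [(isOpen_lt continuous_const continuous_norm).mem_nhds hx'] with y hy
            have : b (a • y) = 0 := by
              apply b.zero_of_le_dist
              rw [dist_zero_right, norm_smul, Real.norm_of_nonneg ha0.le]
              rw [div_lt_iff₀ ha0] at hy
              show (2 : ℝ) ≤ _
              linarith
            simp [hψ1, this]
      _ = κ * (B * C * 9) := by
          rw [integral_const_mul, integral_indicator measurableSet_ball, hC _ (by positivity)]
          field_simp
          norm_num
  by_contra hne
  have hpos : 0 < |∫ x, indicator U u x * laplacian ψ x| := abs_pos.mpr hne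
  set I := |∫ x, indicator U u x * laplacian ψ x|
  have hD : 0 < B * C * 9 + 1 := by positivity
  have := main (I / (2 * (B * C * 9 + 1))) (by positivity)
  rw [div_mul_eq_mul_div, le_div_iff₀ (by positivity)] at this
  nlinarith

theorem kernel_aux {n : ℕ} (c : ℝ) (z : EuclideanSpace ℝ (Fin n)) :
    laplacian (fun z : EuclideanSpace ℝ (Fin n) => -(c / 2) * expNegInvGlue (1 - ‖z‖ ^ 2)) z =
      n * (c * deriv expNegInvGlue (1 - ‖z‖ ^ 2)) +
      fderiv ℝ (fun z : EuclideanSpace ℝ (Fin n) => c * deriv expNegInvGlue (1 - ‖z‖ ^ 2)) z z := by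
  have hE : ContDiff ℝ 2 expNegInvGlue := expNegInvGlue.contDiff (n := 2)
  have hE1 : ContDiff ℝ 1 (deriv expNegInvGlue) := by
    have := hE.iterate_deriv' 1 1
    simpa using this
  set ρ : EuclideanSpace ℝ (Fin n) → ℝ := fun z => c * deriv expNegInvGlue (1 - ‖z‖ ^ 2) with hρ
  have hρd : Differentiable ℝ ρ := by
    have : ContDiff ℝ 1 ρ :=
      contDiff_const.mul (hE1.comp (contDiff_const.sub (contDiff_norm_sq ℝ)))
    exact this.differentiable (by norm_num)
  have h1 : ∀ (i : Fin n) (y : EuclideanSpace ℝ (Fin n)),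
      fderiv ℝ (fun z : EuclideanSpace ℝ (Fin n) => -(c / 2) * expNegInvGlue (1 - ‖z‖ ^ 2)) y
        (EuclideanSpace.single i 1) = ρ y * y i := by
    intro i y
    have a1 : HasFDerivAt (fun z : EuclideanSpace ℝ (Fin n) => 1 - ‖z‖ ^ 2)
        (-(2 • (innerSL ℝ y))) y := ((hasStrictFDerivAt_norm_sq y).hasFDerivAt).const_sub 1
    have a2 : HasDerivAt expNegInvGlue (deriv expNegInvGlue (1 - ‖y‖ ^ 2)) (1 - ‖y‖ ^ 2) :=
      (hE.differentiable (by norm_num) _).hasDerivAt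
    have a3 := (a2.comp_hasFDerivAt y a1).const_mul (-(c / 2))
    have a4 : fderiv ℝ (fun z : EuclideanSpace ℝ (Fin n) =>
      -(c / 2) * expNegInvGlue (1 - ‖z‖ ^ 2)) y = _ := a3.fderiv
    rw [a4]
    simp [hρ, EuclideanSpace.inner_single_right]
    ring
  unfold laplacian
  simp_rw [h1]
  have h2 : ∀ i : Fin n, fderiv ℝ (fun y => ρ y * y i) z (EuclideanSpace.single i 1) =
      ρ z + z i * fderiv ℝ ρ z (EuclideanSpace.single i 1) := by
    intro i
    have b1 : HasFDerivAt (fun y : EuclideanSpace ℝ (Fin n) => y i)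
        (EuclideanSpace.proj i : EuclideanSpace ℝ (Fin n) →L[ℝ] ℝ) z :=
      (EuclideanSpace.proj i : EuclideanSpace ℝ (Fin n) →L[ℝ] ℝ).hasFDerivAt
    have b2 := ((hρd z).hasFDerivAt).mul b1
    have b3 : fderiv ℝ (fun y => ρ y * y i) z = _ := b2.fderiv
    rw [b3]
    simp
  simp_rw [h2]
  rw [Finset.sum_add_distrib]
  congr 1
  · simp [hρ]
  · have hz : z = ∑ i, z i • EuclideanSpace.single i (1 : ℝ) := by
      ext j
      simp [Finset.sum_apply, Pi.single_apply]
    conv_rhs => rw [hz, map_sum]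
    rw [← hz]
    simp

theorem kernel {n : ℕ} (hn : 3 ≤ n) : ∃ Ψ ρ : EuclideanSpace ℝ (Fin n) → ℝ,
    ContDiff ℝ 2 Ψ ∧ ContDiff ℝ 2 ρ ∧ (∀ z, 1 ≤ ‖z‖ → Ψ z = 0) ∧ (∀ z, 1 ≤ ‖z‖ → ρ z = 0) ∧
    (∀ z, 0 ≤ ρ z) ∧ ∫ z, ρ z = 1 ∧ ∀ z, laplacian Ψ z = n * ρ z + fderiv ℝ ρ z z := by
  have hE : ContDiff ℝ 3 expNegInvGlue := expNegInvGlue.contDiff (n := 3)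
  have hE1 : ContDiff ℝ 2 (deriv expNegInvGlue) := by
    have := hE.iterate_deriv' 2 1
    simpa using this
  set k : EuclideanSpace ℝ (Fin n) → ℝ := fun z => deriv expNegInvGlue (1 - ‖z‖ ^ 2) with hk
  have hkc : ContDiff ℝ 2 k := hE1.comp (contDiff_const.sub (contDiff_norm_sq ℝ))
  have hd0 : ∀ s ≤ 0, deriv expNegInvGlue s = 0 := by
    have h1 : ∀ s < 0, deriv expNegInvGlue s = 0 := by
      intro s hs
      have : expNegInvGlue =ᶠ[𝓝 s] fun _ => 0 := by
        filter_upwards [Iio_mem_nhds hs] with t ht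
        exact expNegInvGlue.zero_of_nonpos (le_of_lt ht)
      rw [this.deriv_eq]
      simp
    intro s hs
    have hcl : IsClosed {s | deriv expNegInvGlue s = 0} :=
      isClosed_eq hE1.continuous continuous_const
    have : closure (Iio (0 : ℝ)) ⊆ {s | deriv expNegInvGlue s = 0} :=
      closure_minimal (fun s hs => h1 s hs) hcl
    rw [closure_Iio] at this
    exact this hs
  have hsq : ∀ z : EuclideanSpace ℝ (Fin n), 1 ≤ ‖z‖ → 1 - ‖z‖ ^ 2 ≤ 0 := by
    intro z hz
    nlinarith
  have hk0 : ∀ z, 1 ≤ ‖z‖ → k z = 0 := fun z hz => hd0 _ (hsq z hz)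
  have hkn : ∀ z, 0 ≤ k z := fun z => expNegInvGlue.monotone.deriv_nonneg
  have hkcs : HasCompactSupport k := by
    refine HasCompactSupport.intro (isCompact_closedBall 0 1) fun z hz => hk0 z ?_
    rw [mem_closedBall_zero_iff, not_le] at hz
    exact hz.le
  have hpos : 0 < ∫ z, k z := by
    obtain ⟨s, hs, hs'⟩ := exists_deriv_eq_slope expNegInvGlue (zero_lt_one' ℝ)
      hE.continuous.continuousOn (hE.differentiable (by norm_num)).differentiableOn
    refine hkc.continuous.integral_pos_of_hasCompactSupport_nonneg_nonzero hkcs hkn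
      (x := EuclideanSpace.single ⟨0, by omega⟩ (√(1 - s))) ?_
    have : ‖(EuclideanSpace.single ⟨0, by omega⟩ (√(1 - s)) : EuclideanSpace ℝ (Fin n))‖ ^ 2
        = 1 - s := by
      simp only [EuclideanSpace.norm_single, Real.norm_eq_abs, sq_abs]
      exact Real.sq_sqrt (by linarith [hs.2])
    simp only [hk, this, sub_sub_cancel, hs', expNegInvGlue.zero]
    have := expNegInvGlue.pos_of_pos one_pos
    simp [this.ne']
  set c := (∫ z, k z)⁻¹ with hc
  refine ⟨fun z => -(c / 2) * expNegInvGlue (1 - ‖z‖ ^ 2), fun z => c * k z, ?_,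
    contDiff_const.mul hkc, ?_, ?_, ?_, ?_, ?_⟩
  · exact contDiff_const.mul ((hE.of_le (by norm_num)).comp
      (contDiff_const.sub (contDiff_norm_sq ℝ)))
  · intro z hz
    simp only
    rw [expNegInvGlue.zero_of_nonpos (hsq z hz), mul_zero]
  · intro z hz
    simp only
    rw [hk0 z hz, mul_zero]
  · intro z
    exact mul_nonneg (inv_nonneg.mpr hpos.le) (hkn z)
  · rw [integral_const_mul, hc, inv_mul_cancel₀ hpos.ne']
  · intro z
    exact kernel_aux c z

theorem supp_scale {n : ℕ} {g : EuclideanSpace ℝ (Fin n) → ℝ} (hg : ∀ z, 1 ≤ ‖z‖ → g z = 0)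
    {a : ℝ} (ha : 0 < a) (x : EuclideanSpace ℝ (Fin n)) :
    tsupport (fun y => g (a • (x - y))) ⊆ closedBall x a⁻¹ := by
  refine closure_minimal (fun y hy => ?_) isClosed_closedBall
  by_contra h
  refine hy (hg _ ?_)
  rw [mem_closedBall, not_le, dist_comm, dist_eq_norm] at h
  rw [norm_smul, Real.norm_of_nonneg ha.le]
  calc 1 = a * a⁻¹ := (mul_inv_cancel₀ ha.ne').symm
    _ ≤ _ := by gcongr

/-- Mollified values do not depend on the scale. -/
theorem scale_deriv {n : ℕ} (hn : 3 ≤ n) {f Ψ ρ : EuclideanSpace ℝ (Fin n) → ℝ} {r : ℝ}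
    (hf : Integrable f)
    (hweak : ∀ ψ : EuclideanSpace ℝ (Fin n) → ℝ, ContDiff ℝ 2 ψ → HasCompactSupport ψ →
      tsupport ψ ⊆ ball 0 r → ∫ x, f x * laplacian ψ x = 0)
    (hΨ : ContDiff ℝ 2 Ψ) (hρ : ContDiff ℝ 2 ρ) (hΨ0 : ∀ z, 1 ≤ ‖z‖ → Ψ z = 0)
    (hρ0 : ∀ z, 1 ≤ ‖z‖ → ρ z = 0)
    (hlap : ∀ z, laplacian Ψ z = n * ρ z + fderiv ℝ ρ z z)
    (x : EuclideanSpace ℝ (Fin n)) {a : ℝ} (ha : 0 < a) (hx : ‖x‖ + a⁻¹ < r) :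
    HasDerivAt (fun a : ℝ => ∫ y, f y * (a ^ n * ρ (a • (x - y)))) 0 a := by
  set L : EuclideanSpace ℝ (Fin n) → ℝ := laplacian Ψ with hL
  have hΨc : HasCompactSupport Ψ := by
    refine HasCompactSupport.intro (isCompact_closedBall 0 1) fun z hz => hΨ0 z ?_
    rw [mem_closedBall_zero_iff, not_le] at hz
    exact hz.le
  have hρc : HasCompactSupport ρ := by
    refine HasCompactSupport.intro (isCompact_closedBall 0 1) fun z hz => hρ0 z ?_
    rw [mem_closedBall_zero_iff, not_le] at hz
    exact hz.le
  obtain ⟨M, hM0, hM⟩ := iter_bd hΨ hΨc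
  obtain ⟨N, hN0, hN⟩ := iter_bd hρ hρc
  have hLb : ∀ z, |L z| ≤ n * M := fun z => (lap_le hΨ z).trans (by gcongr; exact hM 2 le_rfl z)
  have hLc : Continuous L := lap_cont hΨ
  have hcs : ∀ a : ℝ, Continuous (fun y : EuclideanSpace ℝ (Fin n) => a • (x - y)) := fun a => by
    fun_prop
  have hρb : ∀ z, ‖ρ z‖ ≤ N := fun z => by simpa using hN 0 (by norm_num) z
  have hd : ∀ y, ∀ t : ℝ, HasDerivAt (fun a : ℝ => f y * (a ^ n * ρ (a • (x - y))))
      (f y * (t ^ (n - 1) * L (t • (x - y)))) t := by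
    intro y t
    have h1 : HasDerivAt (fun a : ℝ => a • (x - y)) (x - y) t := by
      simpa using (hasDerivAt_id t).smul_const (x - y)
    have h2 : HasDerivAt (fun a : ℝ => ρ (a • (x - y))) (fderiv ℝ ρ (t • (x - y)) (x - y)) t :=
      ((hρ.differentiable (by norm_num) (t • (x - y))).hasFDerivAt).comp_hasDerivAt t h1
    have h3 := ((hasDerivAt_pow n t).mul h2).const_mul (f y)
    refine HasDerivAt.congr_deriv (f' := f y * (↑n * t ^ (n - 1) * ρ (t • (x - y)) +
      t ^ n * (fderiv ℝ ρ (t • (x - y))) (x - y))) h3 ?_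
    rw [hlap, map_smul, smul_eq_mul]
    have : t ^ n = t ^ (n - 1) * t := by rw [← pow_succ]; congr 1; omega
    rw [this]
    ring
  have key := hasDerivAt_integral_of_dominated_loc_of_deriv_le (μ := volume)
    (F := fun a y => f y * (a ^ n * ρ (a • (x - y))))
    (F' := fun t y => f y * (t ^ (n - 1) * L (t • (x - y))))
    (s := Icc (a / 2) (2 * a)) (x₀ := a)
    (bound := fun y => ‖f y‖ * ((2 * a) ^ (n - 1) * (n * M)))
    (Icc_mem_nhds (by linarith) (by linarith))
    (Eventually.of_forall fun t => hf.aestronglyMeasurable.mul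
      ((continuous_const.mul (hρ.continuous.comp (hcs t))).aestronglyMeasurable))
    (hf.mul_bdd (c := a ^ n * N)
      ((continuous_const.mul (hρ.continuous.comp (hcs a))).aestronglyMeasurable)
      (Eventually.of_forall fun y => by
        rw [norm_mul, norm_pow, Real.norm_of_nonneg ha.le]
        gcongr
        exact hρb _))
    (hf.aestronglyMeasurable.mul
      ((continuous_const.mul (hLc.comp (hcs a))).aestronglyMeasurable))
    (Eventually.of_forall fun y t ht => by
      have ht0 : 0 ≤ t := by linarith [ht.1]
      rw [norm_mul, norm_mul, norm_pow, Real.norm_of_nonneg ht0]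
      gcongr
      · exact ht.2
      · exact hLb _)
    (hf.norm.mul_const _)
    (Eventually.of_forall fun y t _ => hd y t)
  have hz : ∫ y, f y * (a ^ (n - 1) * L (a • (x - y))) = 0 := by
    have hsub := supp_scale hΨ0 ha x
    have h1 := hweak (fun y => Ψ (a • (x - y)))
      (hΨ.comp ((contDiff_const.sub contDiff_id).const_smul a))
      (HasCompactSupport.of_support_subset_isCompact (isCompact_closedBall x a⁻¹)
        ((subset_tsupport _).trans hsub))
      (hsub.trans fun y hy => by
        rw [mem_closedBall, dist_eq_norm] at hy
        rw [mem_ball_zero_iff]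
        have := norm_add_le x (y - x)
        rw [add_sub_cancel] at this
        linarith)
    simp_rw [lap_affine hΨ] at h1
    have h2 : ∀ y, f y * (a ^ (n - 1) * L (a • (x - y))) =
        (a ^ (n - 1) / a ^ 2) * (f y * (a ^ 2 * laplacian Ψ (a • (x - y)))) := by
      intro y
      field_simp
      rw [hL]
    simp_rw [h2]
    rw [integral_const_mul, h1, mul_zero]
  rw [hz] at key
  exact key.2

theorem mollify_eq {n : ℕ} (hn : 3 ≤ n) {f Ψ ρ : EuclideanSpace ℝ (Fin n) → ℝ} {r : ℝ}
    (hf : Integrable f)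
    (hweak : ∀ ψ : EuclideanSpace ℝ (Fin n) → ℝ, ContDiff ℝ 2 ψ → HasCompactSupport ψ →
      tsupport ψ ⊆ ball 0 r → ∫ x, f x * laplacian ψ x = 0)
    (hΨ : ContDiff ℝ 2 Ψ) (hρ : ContDiff ℝ 2 ρ) (hΨ0 : ∀ z, 1 ≤ ‖z‖ → Ψ z = 0)
    (hρ0 : ∀ z, 1 ≤ ‖z‖ → ρ z = 0) (hρn : ∀ z, 0 ≤ ρ z) (hρ1 : ∫ z, ρ z = 1)
    (hlap : ∀ z, laplacian Ψ z = n * ρ z + fderiv ℝ ρ z z)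
    (x : EuclideanSpace ℝ (Fin n)) (hfx : ContinuousAt f x) {a : ℝ} (ha : 0 < a)
    (hx : ‖x‖ + a⁻¹ < r) :
    ∫ y, f y * (a ^ n * ρ (a • (x - y))) = f x := by
  set h : ℝ → ℝ := fun a => ∫ y, f y * (a ^ n * ρ (a • (x - y))) with hh
  have hder : ∀ t ≥ a, HasDerivAt h 0 t := by
    intro t ht
    refine scale_deriv hn hf hweak hΨ hρ hΨ0 hρ0 hlap x (by linarith) ?_
    have : t⁻¹ ≤ a⁻¹ := inv_anti₀ ha ht
    linarith
  have hconst : ∀ t ≥ a, h t = h a := by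
    intro t ht
    refine constant_of_has_deriv_right_zero (a := a) (b := t) (f := h)
      (fun s hs => (hder s hs.1).continuousAt.continuousWithinAt)
      (fun s hs => (hder s hs.1).hasDerivWithinAt) t ⟨ht, le_rfl⟩
  have hlim : Tendsto h atTop (𝓝 (f x)) := by
    have := convolution_tendsto_right (μ := volume) (l := (atTop : Filter ℝ)) (x₀ := x)
      (z₀ := f x) (g := fun _ => f) (φ := fun (t : ℝ) z => t ^ n * ρ (t • z)) (k := fun _ => x)
      ?_ ?_ ?_ (Eventually.of_forall fun _ => hf.aestronglyMeasurable) ?_ tendsto_const_nhds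
    · refine this.congr fun t => ?_
      rw [convolution_eq_swap]
      simp only [ContinuousLinearMap.lsmul_apply, smul_eq_mul, hh]
      congr 1
      funext y
      ring
    · filter_upwards [eventually_ge_atTop 0] with t ht z
      exact mul_nonneg (pow_nonneg ht _) (hρn _)
    · filter_upwards [eventually_gt_atTop 0] with t ht
      rw [integral_const_mul, Measure.integral_comp_smul_of_nonneg _ _ _ (hR := ht.le), hρ1]
      simp [ht.ne']
    · rw [tendsto_smallSets_iff]
      intro s hs
      obtain ⟨ε, hε, hεs⟩ := Metric.mem_nhds_iff.mp hs
      filter_upwards [eventually_gt_atTop ε⁻¹] with t ht z hz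
      apply hεs
      rw [mem_ball_zero_iff]
      by_contra hcon
      rw [not_lt] at hcon
      have ht0 : 0 < t := (inv_pos.mpr hε).trans ht
      apply hz
      simp only
      rw [hρ0, mul_zero]
      rw [norm_smul, Real.norm_of_nonneg ht0.le]
      calc 1 = ε⁻¹ * ε := (inv_mul_cancel₀ hε.ne').symm
        _ ≤ t * ‖z‖ := by gcongr
    · exact hfx.tendsto.comp tendsto_snd
  have hlim2 : Tendsto h atTop (𝓝 (h a)) :=
    tendsto_const_nhds.congr' (by
      filter_upwards [eventually_ge_atTop a] with t ht
      exact (hconst t ht).symm)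
  exact tendsto_nhds_unique hlim2 hlim

end RS

theorem removable_singularity_harmonic
    (n : ℕ) (hn : 3 ≤ n) (R : ℝ) (hR : 0 < R)
    (u : EuclideanSpace ℝ (Fin n) → ℝ)
    (hreg : ContDiffOn ℝ 2 u (ball (0 : EuclideanSpace ℝ (Fin n)) R \ {0}))
    (hharm : ∀ x ∈ ball (0 : EuclideanSpace ℝ (Fin n)) R \ {0}, laplacian u x = 0)
    (hlittle : u =o[𝓝[≠] (0 : EuclideanSpace ℝ (Fin n))]
      fun x => ‖x‖ ^ ((2 : ℝ) - n)) :
    ∃ v : EuclideanSpace ℝ (Fin n) → ℝ,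
      ContDiffOn ℝ 2 v (ball (0 : EuclideanSpace ℝ (Fin n)) R) ∧
      (∀ x ∈ ball (0 : EuclideanSpace ℝ (Fin n)) R, laplacian v x = 0) ∧
      ∀ x ∈ ball (0 : EuclideanSpace ℝ (Fin n)) R \ {0}, v x = u x := by
  have : Nonempty (Fin n) := ⟨⟨0, by omega⟩⟩
  set U := (ball (0 : EuclideanSpace ℝ (Fin n)) (R / 2) \ {0}) with hU
  have hUo : IsOpen U := isOpen_ball.sdiff isClosed_singleton
  have hVo : IsOpen (ball (0 : EuclideanSpace ℝ (Fin n)) R \ {0}) :=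
    isOpen_ball.sdiff isClosed_singleton
  set f : EuclideanSpace ℝ (Fin n) → ℝ := indicator U u with hf
  have hfi : Integrable f := RS.f_int hn hR hreg.continuousOn hlittle
  obtain ⟨Ψ, ρ, hΨ, hρ, hΨ0, hρ0, hρn, hρ1, hlap⟩ := RS.kernel hn
  set a : ℝ := 8 / R with ha
  have ha0 : 0 < a := by positivity
  set w : EuclideanSpace ℝ (Fin n) → ℝ := fun x => ∫ y, f y * (a ^ n * ρ (a • (x - y))) with hw
  have hwc : ContDiff ℝ 2 w := by
    have hg : ContDiff ℝ 2 (fun z => a ^ n * ρ (a • z)) :=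
      contDiff_const.mul (hρ.comp (contDiff_const_smul a))
    have hgc : HasCompactSupport (fun z => a ^ n * ρ (a • z)) := by
      have : HasCompactSupport ρ := by
        refine HasCompactSupport.intro (isCompact_closedBall 0 1) fun z hz => hρ0 z ?_
        rw [mem_closedBall_zero_iff, not_le] at hz
        exact hz.le
      exact (this.comp_smul ha0.ne').mul_left
    have := hgc.contDiff_convolution_right (𝕜 := ℝ) (μ := volume) (n := 2)
      (ContinuousLinearMap.mul ℝ ℝ) hfi.locallyIntegrable hg
    exact this
  have hwu : ∀ x ∈ ball (0 : EuclideanSpace ℝ (Fin n)) (R / 4) \ {0}, w x = u x := by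
    intro x hx
    have hxU : x ∈ U := ⟨ball_subset_ball (by linarith) hx.1, hx.2⟩
    have hev : f =ᶠ[𝓝 x] u := by
      filter_upwards [hUo.mem_nhds hxU] with y hy
      exact indicator_of_mem hy u
    have hxV : x ∈ ball (0 : EuclideanSpace ℝ (Fin n)) R \ {0} :=
      ⟨ball_subset_ball (by linarith) hx.1, hx.2⟩
    have hcx : ContinuousAt f x :=
      (hreg.continuousOn.continuousAt (hVo.mem_nhds hxV)).congr hev.symm
    have h := RS.mollify_eq hn (r := R / 2) hfi
      (fun ψ h1 h2 h3 => RS.weak hn hR hreg hharm hlittle h1 h2 h3)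
      hΨ hρ hΨ0 hρ0 hρn hρ1 hlap x hcx ha0 (by
        have := mem_ball_zero_iff.mp hx.1
        rw [ha, inv_div]
        linarith)
    rw [← hev.eq_of_nhds]
    exact h
  classical
  refine ⟨fun x => if x = 0 then w 0 else u x, ?_, ?_, ?_⟩
  all_goals
    have e1 : ∀ x ∈ ball (0 : EuclideanSpace ℝ (Fin n)) R \ {0},
        (fun x => if x = 0 then w 0 else u x) =ᶠ[𝓝 x] u := by
      intro x hx
      filter_upwards [hVo.mem_nhds hx] with y hy
      exact if_neg hy.2
    have e2 : (fun x => if x = 0 then w 0 else u x) =ᶠ[𝓝 0] w := by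
      filter_upwards [ball_mem_nhds (0 : EuclideanSpace ℝ (Fin n)) (show 0 < R / 4 by linarith)]
        with y hy
      by_cases h0 : y = 0
      · simp [h0]
      · simp only [h0, if_false]
        exact (hwu y ⟨hy, h0⟩).symm
  · intro x hx
    refine ContDiffAt.contDiffWithinAt ?_
    by_cases h0 : x = 0
    · subst h0
      exact hwc.contDiffAt.congr_of_eventuallyEq e2
    · exact (hreg.contDiffAt (hVo.mem_nhds ⟨hx, h0⟩)).congr_of_eventuallyEq (e1 x ⟨hx, h0⟩)
  · intro x hx
    by_cases h0 : x = 0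
    · subst h0
      rw [RS.lap_congr e2]
      have hz : ∀ y ∈ ball (0 : EuclideanSpace ℝ (Fin n)) (R / 4) \ {0}, laplacian w y = 0 := by
        intro y hy
        have hyo : IsOpen (ball (0 : EuclideanSpace ℝ (Fin n)) (R / 4) \ {0}) :=
          isOpen_ball.sdiff isClosed_singleton
        have : w =ᶠ[𝓝 y] u := by
          filter_upwards [hyo.mem_nhds hy] with z hz
          exact hwu z hz
        rw [RS.lap_congr this]
        exact hharm y ⟨ball_subset_ball (by linarith) hy.1, hy.2⟩
      have t1 : Tendsto (laplacian w) (𝓝[≠] 0) (𝓝 (laplacian w 0)) :=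
        ((RS.lap_cont hwc).tendsto 0).mono_left nhdsWithin_le_nhds
      have t2 : Tendsto (laplacian w) (𝓝[≠] 0) (𝓝 0) := by
        refine tendsto_const_nhds.congr' ?_
        filter_upwards [self_mem_nhdsWithin, mem_nhdsWithin_of_mem_nhds
          (ball_mem_nhds (0 : EuclideanSpace ℝ (Fin n)) (show 0 < R / 4 by linarith))] with y h1 h2
        exact (hz y ⟨h2, h1⟩).symm
      exact tendsto_nhds_unique t1 t2
    · rw [RS.lap_congr (e1 x ⟨hx, h0⟩)]
      exact hharm x ⟨hx, h0⟩
  · intro x hx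
    exact if_neg hx.2
end

section
/- Let 0 < α₁ < n, 0 < α₂ < n with α₁ + α₂ < n, and set R_{α,n} = Γ((n-α)/2) / (π^{n/2} 2^α Γ(α/2)). Then for all distinct x, z ∈ ℝ^n, ∫_{ℝ^n} [R_{α₁,n}/|x-y|^{n-α₁}] · [R_{α₂,n}/|y-z|^{n-α₂}] dy = R_{α₁+α₂,n}/|x-z|^{n-(α₁+α₂)} (semigroup property of Riesz potentials). -/
open MeasureTheory Filter Asymptotics Metric Set Real Topology

open scoped ENNReal

noncomputable def rsPow (a t : ℝ) : ℝ≥0∞ :=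
  if 0 < t then ENNReal.ofReal (t ^ (a - 1) / Real.Gamma a) else 0

noncomputable def rsHeat (n : ℕ) (t : ℝ) (v : EuclideanSpace ℝ (Fin n)) : ℝ≥0∞ :=
  ENNReal.ofReal ((4 * π * t) ^ (-(n : ℝ) / 2) * Real.exp (-(‖v‖ ^ 2 / (4 * t))))

lemma rsPow_measurable (a : ℝ) : Measurable (rsPow a) := by
  unfold rsPow
  refine Measurable.ite measurableSet_Ioi ?_ measurable_const
  fun_prop

lemma rsHeat_measurable (n : ℕ) :
    Measurable (fun p : ℝ × EuclideanSpace ℝ (Fin n) => rsHeat n p.1 p.2) := by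
  unfold rsHeat
  fun_prop

lemma rs_integral (k c : ℝ) (hc : 0 < c) (hk : 0 < k) :
    ∫ t in Ioi (0 : ℝ), t ^ (-c - 1) * Real.exp (-(k / t)) = (1 / k) ^ c * Real.Gamma c := by
  rw [← Real.integral_rpow_mul_exp_neg_mul_Ioi hc hk,
    ← integral_comp_rpow_Ioi (fun u => u ^ (c - 1) * Real.exp (-(k * u))) (p := -1) (by norm_num)]
  refine setIntegral_congr_fun measurableSet_Ioi fun t ht => ?_
  have ht : 0 < t := ht
  simp only [smul_eq_mul, abs_neg, abs_one, one_mul]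
  rw [← Real.rpow_mul ht.le, ← mul_assoc, ← Real.rpow_add ht, Real.rpow_neg_one, div_eq_mul_inv]
  ring_nf

lemma rs_lemmaA (n : ℕ) (α : ℝ) (h : 0 < α) (hα : α < n) (v : EuclideanSpace ℝ (Fin n))
    (hv : v ≠ 0) :
    ∫⁻ t, rsPow (α / 2) t * rsHeat n t v
      = ENNReal.ofReal (rieszConst α n / ‖v‖ ^ ((n : ℝ) - α)) := by
  have hv' : 0 < ‖v‖ := norm_pos_iff.2 hv
  have hc : 0 < ((n : ℝ) - α) / 2 := by linarith
  have hk : 0 < ‖v‖ ^ 2 / 4 := by positivity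
  have hG : 0 < Real.Gamma (α / 2) := Real.Gamma_pos_of_pos (by linarith)
  have hG2 : 0 < Real.Gamma (((n : ℝ) - α) / 2) := Real.Gamma_pos_of_pos hc
  have key := rs_integral _ _ hc hk
  have hint : IntegrableOn (fun t : ℝ => t ^ (-(((n : ℝ) - α) / 2) - 1) *
      Real.exp (-(‖v‖ ^ 2 / 4 / t))) (Ioi 0) :=
    .of_integral_ne_zero (by rw [key]; positivity)
  have e1 : ∀ t, rsPow (α / 2) t * rsHeat n t v = (Ioi (0 : ℝ)).indicator (fun t =>
      ENNReal.ofReal ((4 * π) ^ (-(n : ℝ) / 2) / Real.Gamma (α / 2)) *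
      ENNReal.ofReal (t ^ (-(((n : ℝ) - α) / 2) - 1) * Real.exp (-(‖v‖ ^ 2 / 4 / t)))) t := by
    intro t
    by_cases ht : 0 < t
    · rw [indicator_of_mem (mem_Ioi.2 ht), rsPow, if_pos ht, rsHeat,
        ← ENNReal.ofReal_mul (by positivity), ← ENNReal.ofReal_mul (by positivity),
        Real.mul_rpow (by positivity) ht.le]
      congr 1
      rw [show -(((n : ℝ) - α) / 2) - 1 = (α / 2 - 1) + (-(n : ℝ) / 2) by ring, Real.rpow_add ht,
        div_div]
      ring
    · rw [indicator_of_notMem (by simpa using ht), rsPow, if_neg ht, zero_mul]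
  simp_rw [e1]
  rw [lintegral_indicator measurableSet_Ioi, lintegral_const_mul _ (by fun_prop),
    ← ofReal_integral_eq_lintegral_ofReal hint, key, ← ENNReal.ofReal_mul (by positivity)]
  · congr 1
    rw [rieszConst, one_div_div, Real.div_rpow (by norm_num) (by positivity),
      Real.mul_rpow (by norm_num) (by positivity), ← Real.rpow_natCast ‖v‖ 2,
      ← Real.rpow_mul hv'.le]
    have e2 : (4 : ℝ) = 2 ^ (2 : ℝ) := by norm_num
    rw [e2, ← Real.rpow_mul (by norm_num), ← Real.rpow_mul (by norm_num),
      show (2 : ℝ) * (-(n : ℝ) / 2) = -(n : ℝ) by ring,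
      show (2 : ℝ) * (((n : ℝ) - α) / 2) = (n : ℝ) - α by ring,
      show ((2 : ℕ) : ℝ) * (((n : ℝ) - α) / 2) = (n : ℝ) - α by push_cast; ring,
      Real.rpow_sub (by norm_num) (n : ℝ) α, Real.rpow_neg (by norm_num), neg_div,
      Real.rpow_neg (by positivity)]
    field_simp
  · refine (ae_restrict_iff' measurableSet_Ioi).2 (ae_of_all _ fun t ht => ?_)
    have ht : 0 < t := ht
    simp only [Pi.zero_apply]
    positivity

lemma rs_lemmaC (a b : ℝ) (ha : 0 < a) (hb : 0 < b) (w : ℝ) :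
    ∫⁻ s, rsPow a s * rsPow b (w - s) = rsPow (a + b) w := by
  have hGa := Real.Gamma_pos_of_pos ha
  have hGb := Real.Gamma_pos_of_pos hb
  have hGab := Real.Gamma_pos_of_pos (add_pos ha hb)
  by_cases hw : 0 < w
  · have key : ∫ s in Ioo (0 : ℝ) w, s ^ (a - 1) * (w - s) ^ (b - 1)
        = w ^ (a + b - 1) * (Real.Gamma a * Real.Gamma b / Real.Gamma (a + b)) := by
      have h := Complex.betaIntegral_scaled a b hw
      rw [Complex.betaIntegral_eq_Gamma_mul_div _ _ (by simpa) (by simpa),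
        intervalIntegral.integral_of_le hw.le, ← Complex.ofReal_add, Complex.Gamma_ofReal,
        Complex.Gamma_ofReal, Complex.Gamma_ofReal, integral_Ioc_eq_integral_Ioo] at h
      apply Complex.ofReal_injective
      rw [← integral_complex_ofReal]
      refine Eq.trans (setIntegral_congr_fun measurableSet_Ioo fun s hs => ?_) (h.trans ?_)
      · have h1 : 0 < s := hs.1
        have h2 : 0 < w - s := by linarith [hs.2]
        push_cast
        rw [Complex.ofReal_cpow h1.le, Complex.ofReal_cpow h2.le]
        push_cast
        rfl
      · push_cast
        rw [Complex.ofReal_cpow hw.le]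
        push_cast
        rfl
    have hint : IntegrableOn (fun s : ℝ => s ^ (a - 1) * (w - s) ^ (b - 1)) (Ioo 0 w) :=
      .of_integral_ne_zero (by rw [key]; positivity)
    have e1 : ∀ s, rsPow a s * rsPow b (w - s) = (Ioo (0 : ℝ) w).indicator (fun s =>
        ENNReal.ofReal (1 / (Real.Gamma a * Real.Gamma b)) *
        ENNReal.ofReal (s ^ (a - 1) * (w - s) ^ (b - 1))) s := by
      intro s
      by_cases hs : s ∈ Ioo (0 : ℝ) w
      · have h1 : 0 < s := hs.1
        have h2 : 0 < w - s := by linarith [hs.2]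
        rw [indicator_of_mem hs, rsPow, rsPow, if_pos h1, if_pos h2,
          ← ENNReal.ofReal_mul (by positivity), ← ENNReal.ofReal_mul (by positivity)]
        congr 1
        field_simp
      · rw [indicator_of_notMem hs, rsPow, rsPow]
        by_cases h1 : 0 < s
        · have h2 : ¬ 0 < w - s := fun h => hs ⟨h1, by linarith⟩
          rw [if_neg h2, mul_zero]
        · rw [if_neg h1, zero_mul]
    simp_rw [e1]
    rw [lintegral_indicator measurableSet_Ioo, lintegral_const_mul _ (by fun_prop),
      ← ofReal_integral_eq_lintegral_ofReal hint, key, ← ENNReal.ofReal_mul (by positivity),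
      rsPow, if_pos hw]
    · congr 1
      field_simp
    · refine (ae_restrict_iff' measurableSet_Ioo).2 (ae_of_all _ fun s hs => ?_)
      have h1 : 0 < s := hs.1
      have h2 : 0 < w - s := by linarith [hs.2]
      simp only [Pi.zero_apply]
      positivity
  · have e1 : ∀ s, rsPow a s * rsPow b (w - s) = 0 := by
      intro s
      rw [rsPow, rsPow]
      by_cases h1 : 0 < s
      · rw [if_neg (show ¬ 0 < w - s by linarith), mul_zero]
      · rw [if_neg h1, zero_mul]
    simp_rw [e1]
    rw [rsPow, if_neg hw, lintegral_zero]

lemma rs_lemmaB (n : ℕ) (s t : ℝ) (hs : 0 < s) (ht : 0 < t) (x z : EuclideanSpace ℝ (Fin n)) :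
    ∫⁻ y, rsHeat n s (x - y) * rsHeat n t (y - z) = rsHeat n (s + t) (x - z) := by
  set m : EuclideanSpace ℝ (Fin n) := (t / (s + t)) • x + (s / (s + t)) • z with hm
  set b : ℝ := (s + t) / (4 * s * t) with hb
  have hst : 0 < s + t := by linarith
  have hb0 : 0 < b := by positivity
  have key : ∫ v : EuclideanSpace ℝ (Fin n), Real.exp (-b * ‖v‖ ^ 2) = (π / b) ^ ((n : ℝ) / 2) := by
    rw [GaussianFourier.integral_rexp_neg_mul_sq_norm hb0, finrank_euclideanSpace_fin]
  have hint : Integrable (fun v : EuclideanSpace ℝ (Fin n) => Real.exp (-b * ‖v‖ ^ 2)) :=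
    .of_integral_ne_zero (by rw [key]; positivity)
  have sq : ∀ y, ‖x - y‖ ^ 2 / (4 * s) + ‖y - z‖ ^ 2 / (4 * t)
      = b * ‖y - m‖ ^ 2 + ‖x - z‖ ^ 2 / (4 * (s + t)) := by
    intro y
    have hx : x - y = (s / (s + t)) • (x - z) - (y - m) := by
      rw [hm]
      match_scalars <;> field_simp <;> ring
    have hz : y - z = (t / (s + t)) • (x - z) + (y - m) := by
      rw [hm]
      match_scalars <;> field_simp <;> ring
    rw [hx, hz, norm_sub_sq_real, norm_add_sq_real, norm_smul, norm_smul, inner_smul_left,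
      inner_smul_left, mul_pow, mul_pow, Real.norm_eq_abs, Real.norm_eq_abs, sq_abs, sq_abs, hb]
    simp only [conj_trivial]
    field_simp
    ring
  have e1 : ∀ y, rsHeat n s (x - y) * rsHeat n t (y - z) =
      ENNReal.ofReal ((4 * π * s) ^ (-(n : ℝ) / 2) * (4 * π * t) ^ (-(n : ℝ) / 2) *
        Real.exp (-(‖x - z‖ ^ 2 / (4 * (s + t))))) *
      ENNReal.ofReal (Real.exp (-b * ‖y - m‖ ^ 2)) := by
    intro y
    rw [rsHeat, rsHeat, ← ENNReal.ofReal_mul (by positivity), ← ENNReal.ofReal_mul (by positivity)]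
    congr 1
    rw [mul_mul_mul_comm, ← Real.exp_add, mul_assoc _ (Real.exp _) (Real.exp _), ← Real.exp_add]
    congr 2
    linarith [sq y]
  simp_rw [e1]
  rw [lintegral_const_mul _ (by fun_prop),
    lintegral_sub_right_eq_self (fun v => ENNReal.ofReal (Real.exp (-b * ‖v‖ ^ 2))) m,
    ← ofReal_integral_eq_lintegral_ofReal hint (ae_of_all _ fun _ => (Real.exp_pos _).le), key,
    ← ENNReal.ofReal_mul (by positivity), rsHeat]
  congr 1
  have : (4 * π * s) ^ (-(n : ℝ) / 2) * (4 * π * t) ^ (-(n : ℝ) / 2) * (π / b) ^ ((n : ℝ) / 2)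
      = (4 * π * (s + t)) ^ (-(n : ℝ) / 2) := by
    rw [neg_div, Real.rpow_neg (by positivity), Real.rpow_neg (by positivity),
      Real.rpow_neg (by positivity), ← Real.inv_rpow (by positivity),
      ← Real.inv_rpow (by positivity), ← Real.inv_rpow (by positivity),
      ← Real.mul_rpow (by positivity) (by positivity),
      ← Real.mul_rpow (by positivity) (by positivity)]
    congr 1
    rw [hb]
    field_simp
    try ring
  rw [← this]
  ring

set_option maxHeartbeats 2000000 in
lemma rs_lintegral (n : ℕ) (hn : 1 ≤ n) (α₁ α₂ : ℝ) (h1 : 0 < α₁) (h2 : 0 < α₂)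
    (hsum : α₁ + α₂ < n) (x z : EuclideanSpace ℝ (Fin n)) (hxz : x ≠ z) :
    ∫⁻ y, ENNReal.ofReal (rieszConst α₁ n / ‖x - y‖ ^ ((n : ℝ) - α₁)) *
      ENNReal.ofReal (rieszConst α₂ n / ‖y - z‖ ^ ((n : ℝ) - α₂))
      = ENNReal.ofReal (rieszConst (α₁ + α₂) n / ‖x - z‖ ^ ((n : ℝ) - (α₁ + α₂))) := by
  have mP := rsPow_measurable
  have mH := rsHeat_measurable n
  have mH1 : ∀ v, Measurable fun t => rsHeat n t v := fun v => by
    unfold rsHeat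
    fun_prop
  have : Nonempty (Fin n) := ⟨⟨0, hn⟩⟩
  have mK : Measurable (fun p : EuclideanSpace ℝ (Fin n) × ℝ × ℝ =>
      (rsPow (α₁ / 2) p.2.1 * rsHeat n p.2.1 (x - p.1)) *
      (rsPow (α₂ / 2) p.2.2 * rsHeat n p.2.2 (p.1 - z))) := by
    have i1 : Measurable (fun p : EuclideanSpace ℝ (Fin n) × ℝ × ℝ =>
      rsHeat n p.2.1 (x - p.1)) := mH.comp (g := fun q : ℝ × EuclideanSpace ℝ (Fin n) => rsHeat n q.1 q.2)
        (f := fun p : EuclideanSpace ℝ (Fin n) × ℝ × ℝ => (p.2.1, x - p.1)) (by fun_prop)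
    have i2 : Measurable (fun p : EuclideanSpace ℝ (Fin n) × ℝ × ℝ =>
      rsHeat n p.2.2 (p.1 - z)) := mH.comp (g := fun q : ℝ × EuclideanSpace ℝ (Fin n) => rsHeat n q.1 q.2)
        (f := fun p : EuclideanSpace ℝ (Fin n) × ℝ × ℝ => (p.2.2, p.1 - z)) (by fun_prop)
    have i3 := mP (α₁ / 2)
    have i4 := mP (α₂ / 2)
    fun_prop
  have mL : Measurable (fun p : ℝ × ℝ =>
      rsPow (α₁ / 2) p.1 * rsPow (α₂ / 2) (p.2 - p.1) * rsHeat n p.2 (x - z)) := by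
    have i3 := mP (α₁ / 2)
    have i4 := mP (α₂ / 2)
    have i5 := mH1 (x - z)
    fun_prop
  have hae : ∀ᵐ y : EuclideanSpace ℝ (Fin n), y ≠ x ∧ y ≠ z := by
    filter_upwards [Measure.ae_ne volume x, Measure.ae_ne volume z] with y a b using ⟨a, b⟩
  calc _ = ∫⁻ y, ∫⁻ p : ℝ × ℝ, (rsPow (α₁ / 2) p.1 * rsHeat n p.1 (x - y)) *
      (rsPow (α₂ / 2) p.2 * rsHeat n p.2 (y - z)) := by
        refine lintegral_congr_ae (hae.mono fun y hy => ?_)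
        simp only
        rw [← rs_lemmaA n α₁ h1 (by linarith) _ (sub_ne_zero.2 hy.1.symm),
          ← rs_lemmaA n α₂ h2 (by linarith) _ (sub_ne_zero.2 hy.2), Measure.volume_eq_prod]
        exact (lintegral_prod_mul (((mP _).mul (mH1 _)).aemeasurable)
            (((mP _).mul (mH1 _)).aemeasurable)).symm
    _ = ∫⁻ p : ℝ × ℝ, ∫⁻ y, (rsPow (α₁ / 2) p.1 * rsHeat n p.1 (x - y)) *
      (rsPow (α₂ / 2) p.2 * rsHeat n p.2 (y - z)) :=
        lintegral_lintegral_swap mK.aemeasurable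
    _ = ∫⁻ p : ℝ × ℝ, rsPow (α₁ / 2) p.1 * rsPow (α₂ / 2) p.2 * rsHeat n (p.1 + p.2) (x - z) := by
        refine lintegral_congr fun p => ?_
        by_cases hp : 0 < p.1 ∧ 0 < p.2
        · rw [← rs_lemmaB n p.1 p.2 hp.1 hp.2, ← lintegral_const_mul]
          · refine lintegral_congr fun y => ?_
            ring
          · unfold rsHeat
            fun_prop
        · have : rsPow (α₁ / 2) p.1 * rsPow (α₂ / 2) p.2 = 0 := by
            by_cases h : 0 < p.1
            · have h' : ¬ 0 < p.2 := fun h' => hp ⟨h, h'⟩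
              simp [rsPow, h']
            · simp [rsPow, h]
          rw [this, zero_mul]
          simp_rw [mul_mul_mul_comm, this, zero_mul]
          exact lintegral_zero
    _ = ∫⁻ s, ∫⁻ t, rsPow (α₁ / 2) s * rsPow (α₂ / 2) t * rsHeat n (s + t) (x - z) := by
        rw [Measure.volume_eq_prod, lintegral_prod]
        have i3 := mP (α₁ / 2)
        have i4 := mP (α₂ / 2)
        have i5 := mH1 (x - z)
        exact Measurable.aemeasurable (by fun_prop)
    _ = ∫⁻ s, ∫⁻ w, rsPow (α₁ / 2) s * rsPow (α₂ / 2) (w - s) * rsHeat n w (x - z) := by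
        refine lintegral_congr fun s => ?_
        rw [← lintegral_sub_right_eq_self _ s]
        simp
    _ = ∫⁻ w, ∫⁻ s, rsPow (α₁ / 2) s * rsPow (α₂ / 2) (w - s) * rsHeat n w (x - z) :=
        lintegral_lintegral_swap mL.aemeasurable
    _ = ∫⁻ w, rsPow ((α₁ + α₂) / 2) w * rsHeat n w (x - z) := by
        refine lintegral_congr fun w => ?_
        have i3 := mP (α₁ / 2)
        have i4 := mP (α₂ / 2)
        rw [lintegral_mul_const _ (by fun_prop), rs_lemmaC _ _ (by linarith) (by linarith),
          add_div]
    _ = _ := rs_lemmaA n _ (by linarith) hsum _ (sub_ne_zero.2 hxz)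

lemma rs_const_pos (n : ℕ) (α : ℝ) (h : 0 < α) (hα : α < n) : 0 < rieszConst α n := by
  have hG : 0 < Real.Gamma (α / 2) := Real.Gamma_pos_of_pos (by linarith)
  have hG2 : 0 < Real.Gamma (((n : ℝ) - α) / 2) := Real.Gamma_pos_of_pos (by linarith)
  unfold rieszConst
  positivity

theorem riesz_semigroup
    (n : ℕ) (hn : 1 ≤ n) (α₁ α₂ : ℝ) (h1 : 0 < α₁) (h2 : 0 < α₂)
    (hsum : α₁ + α₂ < n)
    (x z : EuclideanSpace ℝ (Fin n)) (hxz : x ≠ z) :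
    Integrable (fun y : EuclideanSpace ℝ (Fin n) =>
      (rieszConst α₁ n / ‖x - y‖ ^ ((n : ℝ) - α₁)) *
      (rieszConst α₂ n / ‖y - z‖ ^ ((n : ℝ) - α₂))) ∧
    ∫ y : EuclideanSpace ℝ (Fin n),
      (rieszConst α₁ n / ‖x - y‖ ^ ((n : ℝ) - α₁)) *
      (rieszConst α₂ n / ‖y - z‖ ^ ((n : ℝ) - α₂))
      = rieszConst (α₁ + α₂) n / ‖x - z‖ ^ ((n : ℝ) - (α₁ + α₂)) := by
  have p1 := rs_const_pos n α₁ h1 (by linarith)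
  have p2 := rs_const_pos n α₂ h2 (by linarith)
  have p3 := rs_const_pos n (α₁ + α₂) (by linarith) hsum
  have key := rs_lintegral n hn α₁ α₂ h1 h2 hsum x z hxz
  have hm : AEStronglyMeasurable (fun y : EuclideanSpace ℝ (Fin n) =>
      (rieszConst α₁ n / ‖x - y‖ ^ ((n : ℝ) - α₁)) *
      (rieszConst α₂ n / ‖y - z‖ ^ ((n : ℝ) - α₂))) :=
    Measurable.aestronglyMeasurable (by fun_prop)
  have hnn : ∀ y : EuclideanSpace ℝ (Fin n), 0 ≤ (rieszConst α₁ n / ‖x - y‖ ^ ((n : ℝ) - α₁)) *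
      (rieszConst α₂ n / ‖y - z‖ ^ ((n : ℝ) - α₂)) := fun y => by positivity
  have key' : ∫⁻ y, ENNReal.ofReal ((rieszConst α₁ n / ‖x - y‖ ^ ((n : ℝ) - α₁)) *
      (rieszConst α₂ n / ‖y - z‖ ^ ((n : ℝ) - α₂)))
      = ENNReal.ofReal (rieszConst (α₁ + α₂) n / ‖x - z‖ ^ ((n : ℝ) - (α₁ + α₂))) := by
    rw [← key]
    refine lintegral_congr fun y => ?_
    rw [ENNReal.ofReal_mul (by positivity)]
  constructor
  · rw [← lintegral_ofReal_ne_top_iff_integrable hm (ae_of_all _ hnn), key']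
    exact ENNReal.ofReal_ne_top
  · rw [integral_eq_lintegral_of_nonneg_ae (ae_of_all _ hnn) hm, key',
      ENNReal.toReal_ofReal (by positivity)]
end
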